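/- arXiv:2501.00831 — 6 statements merged into one kernel-verified Lean document; each statement's English description precedes it below -/
import Mathlib

section
/- For every n ≥ 1, the minimum depth of a hazard-free decision tree computing the multiplexer function MUX_n equals 2^n + n, i.e., depth_u(MUX_n) = 2^n + n. -/
/-- Kleene's three-valued domain: `none` is the unstable value `u`,
`some b` is a stable Boolean value. -/
abbrev K : Type := Option Bool

namespace HF

variable {ι : Type} [Fintype ι] [DecidableEq ι]

/-- Instability order on inputs: `Below x y` means `x ≤ y`, i.e. each coordinate of `x`
is either `u` or equal to the corresponding coordinate of `y`. -/
def Below (x y : ι → K) : Prop := ∀ i, x i = none ∨ x i = y i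

/-- `x` is strictly below `y` in the instability order. -/
def StrictBelow (x y : ι → K) : Prop := Below x y ∧ x ≠ y

/-- `y` is strictly above `x` in the instability order. -/
def StrictAbove (y x : ι → K) : Prop := Below x y ∧ y ≠ x

/-- `x : ι → Bool` is a resolution of `y : ι → K`. -/
def Resolves (y : ι → K) (x : ι → Bool) : Prop := ∀ i, y i = none ∨ y i = some (x i)

instance (y : ι → K) : DecidablePred (Resolves y) := fun x => by
  unfold Resolves; infer_instance

/-- The hazard-free extension of a Boolean function `f`. -/
def hfExt (f : (ι → Bool) → Bool) (y : ι → K) : K :=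
  if ∀ x, Resolves y x → f x = true then some true
  else if ∀ x, Resolves y x → f x = false then some false
  else none

/-- Number of unstable (`u`) coordinates of an input. -/
def numU (x : ι → K) : ℕ := (Finset.univ.filter fun i => x i = none).card

/-- Ternary (hazard-free) decision trees: leaves are labeled by values in `K`,
internal nodes query a position and have children for responses `0`, `u`, `1`. -/
inductive TDT (ι : Type) : Type where
  | leaf : K → TDT ι
  | node : ι → TDT ι → TDT ι → TDT ι → TDT ι

namespace TDT

/-- Evaluate a ternary decision tree on an input in `K^ι`. -/
def eval : TDT ι → (ι → K) → K
  | .leaf b, _ => b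
  | .node i t0 tu t1, x =>
    match x i with
    | some false => eval t0 x
    | none => eval tu x
    | some true => eval t1 x

/-- Depth of a ternary decision tree. -/
def depth : TDT ι → ℕ
  | .leaf _ => 0
  | .node _ t0 tu t1 => max (max (depth t0) (depth tu)) (depth t1) + 1

/-- Size (number of leaves) of a ternary decision tree. -/
def size : TDT ι → ℕ
  | .leaf _ => 1
  | .node _ t0 tu t1 => size t0 + size tu + size t1

end TDT

/-- Boolean decision trees. -/
inductive BDT (ι : Type) : Type where
  | leaf : Bool → BDT ι
  | node : ι → BDT ι → BDT ι → BDT ι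

namespace BDT

/-- Evaluate a Boolean decision tree. -/
def eval : BDT ι → (ι → Bool) → Bool
  | .leaf b, _ => b
  | .node i t0 t1, x => if x i then eval t1 x else eval t0 x

/-- Depth of a Boolean decision tree. -/
def depth : BDT ι → ℕ
  | .leaf _ => 0
  | .node _ t0 t1 => max (depth t0) (depth t1) + 1

/-- Size (number of leaves) of a Boolean decision tree. -/
def size : BDT ι → ℕ
  | .leaf _ => 1
  | .node _ t0 t1 => size t0 + size t1

end BDT

/-- A ternary tree computes (the hazard-free extension of) the Boolean function `f`. -/
def ComputesHF (f : (ι → Bool) → Bool) (T : TDT ι) : Prop := ∀ x, T.eval x = hfExt f x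

/-- A ternary tree computes a `K`-valued function `g`. -/
def ComputesT (g : (ι → K) → K) (T : TDT ι) : Prop := ∀ x, T.eval x = g x

/-- A Boolean tree computes the Boolean function `f`. -/
def ComputesB (f : (ι → Bool) → Bool) (T : BDT ι) : Prop := ∀ x, T.eval x = f x

/-- A `k`-bit hazard-free decision tree for `f`: correct on all inputs with at most
`k` unstable coordinates. -/
def KComputes (k : ℕ) (f : (ι → Bool) → Bool) (T : TDT ι) : Prop :=
  ∀ x : ι → K, numU x ≤ k → T.eval x = hfExt f x

/-- Minimum depth of a ternary decision tree computing a `K`-valued function. -/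
noncomputable def depthT (g : (ι → K) → K) : ℕ :=
  sInf {d | ∃ T : TDT ι, ComputesT g T ∧ T.depth = d}

/-- Hazard-free decision tree depth of a Boolean function. -/
noncomputable def depthU (f : (ι → Bool) → Bool) : ℕ :=
  sInf {d | ∃ T : TDT ι, ComputesHF f T ∧ T.depth = d}

/-- Hazard-free decision tree size (minimum number of leaves). -/
noncomputable def sizeU (f : (ι → Bool) → Bool) : ℕ :=
  sInf {s | ∃ T : TDT ι, ComputesHF f T ∧ T.size = s}

/-- Boolean decision tree size (minimum number of leaves). -/
noncomputable def sizeB (f : (ι → Bool) → Bool) : ℕ :=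
  sInf {s | ∃ T : BDT ι, ComputesB f T ∧ T.size = s}

/-- The multiplexer function `MUX n` on `n` selector bits and `2^n` data bits. -/
def MUX (n : ℕ) (z : (Fin n ⊕ (Fin n → Bool)) → Bool) : Bool :=
  z (Sum.inr fun i => z (Sum.inl i))

/-- Hazard-free sensitivity of `g` at `x`. -/
noncomputable def sensAt (g : (ι → K) → K) (x : ι → K) : ℕ :=
  Set.ncard {i : ι | ∃ y : ι → K, y i ≠ x i ∧ (∀ j, j ≠ i → y j = x j) ∧ g y ≠ g x}

/-- Hazard-free sensitivity of `g`. -/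
noncomputable def sens (g : (ι → K) → K) : ℕ := ⨆ x : ι → K, sensAt g x

/-- Hazard-free sensitivity of `g` restricted to inputs with output value `b`. -/
noncomputable def sensVal (g : (ι → K) → K) (b : K) : ℕ :=
  ⨆ x : {x : ι → K // g x = b}, sensAt g x.1

/-- Hazard-free block sensitivity of `g` at `x`. -/
noncomputable def bsensAt (g : (ι → K) → K) (x : ι → K) : ℕ :=
  sSup {k : ℕ | ∃ B : Fin k → Finset ι, (∀ j, (B j).Nonempty) ∧
    (∀ j j', j ≠ j' → Disjoint (B j) (B j')) ∧
    ∀ j, ∃ y : ι → K, (∀ i, y i ≠ x i ↔ i ∈ B j) ∧ g y ≠ g x}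

/-- Hazard-free block sensitivity of `g`. -/
noncomputable def bsens (g : (ι → K) → K) : ℕ := ⨆ x, bsensAt g x

/-- Hazard-free certificate complexity of `g` at `x`. -/
noncomputable def ccAt (g : (ι → K) → K) (x : ι → K) : ℕ :=
  sInf {k : ℕ | ∃ S : Finset ι, S.card = k ∧
    ∀ y : ι → K, (∀ i ∈ S, y i = x i) → g y = g x}

/-- Hazard-free certificate complexity of `g`. -/
noncomputable def cc (g : (ι → K) → K) : ℕ := ⨆ x, ccAt g x

/-- Hazard-free certificate complexity of `g` restricted to inputs with output value `b`. -/
noncomputable def ccVal (g : (ι → K) → K) (b : K) : ℕ :=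
  ⨆ x : {x : ι → K // g x = b}, ccAt g x.1

/-- Boolean sensitivity of a Boolean function. -/
noncomputable def boolSens (f : (ι → Bool) → Bool) : ℕ :=
  ⨆ x : ι → Bool, Set.ncard {i : ι | f (Function.update x i (!(x i))) ≠ f x}

/-- `p` is a prime implicant of `f`. -/
def PrimeImplicant (f : (ι → Bool) → Bool) (p : ι → K) : Prop :=
  hfExt f p = some true ∧ ∀ q, StrictBelow q p → hfExt f q ≠ some true

/-- `p` is a prime implicate of `f`. -/
def PrimeImplicate (f : (ι → Bool) → Bool) (p : ι → K) : Prop :=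
  hfExt f p = some false ∧ ∀ q, StrictBelow q p → hfExt f q ≠ some false

/-- Size of an implicant/implicate: the number of stable coordinates. -/
noncomputable def isize (p : ι → K) : ℕ := Set.ncard {i : ι | p i ≠ none}

/-- Hamming distance between two inputs in `K^ι`. -/
noncomputable def hamm (x y : ι → K) : ℕ := Set.ncard {i : ι | x i ≠ y i}

/-- Hazard-free evaluation of a literal (variable and polarity). -/
def litEval (x : ι → K) (l : ι × Bool) : K := if l.2 then x l.1 else (x l.1).map not

/-- Hazard-free evaluation of a term (conjunction of literals). -/
def termEval (t : Finset (ι × Bool)) (x : ι → K) : K :=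
  if ∀ l ∈ t, litEval x l = some true then some true
  else if ∃ l ∈ t, litEval x l = some false then some false
  else none

/-- Hazard-free evaluation of a clause (disjunction of literals). -/
def clauseEval (c : Finset (ι × Bool)) (x : ι → K) : K :=
  if ∃ l ∈ c, litEval x l = some true then some true
  else if ∀ l ∈ c, litEval x l = some false then some false
  else none

/-- Hazard-free evaluation of a DNF formula (a set of terms). -/
def dnfEval (D : Finset (Finset (ι × Bool))) (x : ι → K) : K :=
  if ∃ t ∈ D, termEval t x = some true then some true
  else if ∀ t ∈ D, termEval t x = some false then some false
  else none

/-- Hazard-free evaluation of a CNF formula (a set of clauses). -/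
def cnfEval (C : Finset (Finset (ι × Bool))) (x : ι → K) : K :=
  if ∀ c ∈ C, clauseEval c x = some true then some true
  else if ∃ c ∈ C, clauseEval c x = some false then some false
  else none

/-- A function `g : K^ι → K` is weakly hazard-free: it is monotone with respect to the
instability order, and whenever all points strictly above `x` have the same value `b`
(and some such point exists), `g x = b` as well. -/
def WeaklyHF (g : (ι → K) → K) : Prop :=
  (∀ x y, Below x y → g x = none ∨ g x = g y) ∧
  (∀ x (b : K), (∃ y, StrictAbove y x) → (∀ y, StrictAbove y x → g y = b) → g x = b)

/-- The subcube `C(x)` is monochromatic for `f`. -/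
def Mono (f : (ι → Bool) → Bool) (x : ι → K) : Prop :=
  ∀ y z : ι → Bool, Resolves x y → Resolves x z → f y = f z

/-- The subcube `C(x)` is colorful for `f` (contains both a 0-point and a 1-point). -/
def Colorful (f : (ι → Bool) → Bool) (x : ι → K) : Prop :=
  ∃ y z : ι → Bool, Resolves x y ∧ Resolves x z ∧ f y ≠ f z

/-- `C(x)` is a minimal colorful cube for `f`. -/
def MinColorful (f : (ι → Bool) → Bool) (x : ι → K) : Prop :=
  Colorful f x ∧ ∀ i, x i = none →
    (Mono f (Function.update x i (some false)) ∨ Mono f (Function.update x i (some true)))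

/-- A Boolean function is non-degenerate if it depends on every input position. -/
def Nondegenerate (f : (ι → Bool) → Bool) : Prop :=
  ∀ i : ι, ∃ x y : ι → Bool, (∀ j, j ≠ i → x j = y j) ∧ x i ≠ y i ∧ f x ≠ f y

/-- The `n`-input AND function. -/
def ANDf (n : ℕ) (x : Fin n → Bool) : Bool := decide (∀ i, x i = true)

theorem hfExt_eq_some_false_iff (f : (ι → Bool) → Bool) (y : ι → K) :
    hfExt f y = some false ↔ ∀ x, Resolves y x → f x = false := by
  have hres : Resolves y fun i => (y i).getD false := by
    intro i
    cases h : y i <;> simp [h]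
  unfold hfExt
  split_ifs with h₁ h₂
  · simp only [Option.some.injEq, Bool.true_eq_false, false_iff, not_forall]
    exact ⟨_, hres, by simp [h₁ _ hres]⟩
  · simpa using h₂
  · simpa using h₂

namespace TDT

/-- The tree that queries the positions in a list in order, updating the assignment `ρ` with the
responses, and outputs the value of `g` at the final assignment. -/
def queryAll (g : (ι → K) → K) : List ι → (ι → K) → TDT ι
  | [], ρ => .leaf (g ρ)
  | i :: l, ρ => .node i (queryAll g l (Function.update ρ i (some false)))
      (queryAll g l (Function.update ρ i none)) (queryAll g l (Function.update ρ i (some true)))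

omit [Fintype ι] in
theorem depth_queryAll (g : (ι → K) → K) (l : List ι) (ρ : ι → K) :
    (queryAll g l ρ).depth = l.length := by
  induction l generalizing ρ with
  | nil => rfl
  | cons i l ih => simp [queryAll, depth, ih]

omit [Fintype ι] in
theorem eval_queryAll (g : (ι → K) → K) (l : List ι) (ρ x : ι → K) :
    (queryAll g l ρ).eval x = g fun j => if j ∈ l then x j else ρ j := by
  induction l generalizing ρ with
  | nil => simp [queryAll, eval]
  | cons i l ih =>
    have h : (queryAll g (i :: l) ρ).eval x =
        (queryAll g l (Function.update ρ i (x i))).eval x := by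
      rcases hx : x i with _ | _ | _ <;> simp [queryAll, eval, hx]
    rw [h, ih]
    congr 1
    funext j
    by_cases hj : j = i
    · subst hj; simp
    · simp [hj]

/-- The subtree reached from a node after the response `v`. -/
def child (t0 tu t1 : TDT ι) : K → TDT ι
  | some false => t0
  | none => tu
  | some true => t1

omit [Fintype ι] [DecidableEq ι] in
theorem eval_node (i : ι) (t0 tu t1 : TDT ι) (x : ι → K) :
    (node i t0 tu t1).eval x = (child t0 tu t1 (x i)).eval x := by
  rcases hx : x i with _ | _ | _ <;> simp [eval, child, hx]

omit [Fintype ι] [DecidableEq ι] in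
theorem depth_child_lt (i : ι) (t0 tu t1 : TDT ι) (v : K) :
    (child t0 tu t1 v).depth < (node i t0 tu t1).depth := by
  rcases v with _ | _ | _ <;> simp [child, depth]

/-- `T` agrees with `g` on all inputs that coincide with `z` on `Q`. -/
def AgreesOn (T : TDT ι) (g : (ι → K) → K) (Q : Finset ι) (z : ι → K) : Prop :=
  ∀ y, (∀ i ∈ Q, y i = z i) → T.eval y = g y

omit [Fintype ι] in
theorem AgreesOn.child {g : (ι → K) → K} {Q : Finset ι} {z : ι → K} {i : ι} {t0 tu t1 : TDT ι}
    (h : (node i t0 tu t1).AgreesOn g Q z) :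
    (child t0 tu t1 (z i)).AgreesOn g (insert i Q) z := by
  intro y hy
  rw [← h y fun j hj => hy j (Finset.mem_insert_of_mem hj), eval_node,
    hy i (Finset.mem_insert_self i Q)]

omit [Fintype ι] [DecidableEq ι] in
theorem AgreesOn.congr {T : TDT ι} {g : (ι → K) → K} {Q : Finset ι} {z w : ι → K}
    (h : T.AgreesOn g Q z) (hzw : ∀ i ∈ Q, w i = z i) : T.AgreesOn g Q w :=
  fun y hy => h y fun i hi => (hy i hi).trans (hzw i hi)

omit [Fintype ι] in
theorem AgreesOn.leaf_eq {b : K} {g : (ι → K) → K} {Q : Finset ι} {z : ι → K}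
    (h : (leaf b).AgreesOn g Q z) {i : ι} (hi : i ∉ Q) (v : K) :
    g (Function.update z i v) = g z := by
  exact (h _ fun _ hj => Function.update_of_ne (ne_of_mem_of_not_mem hj hi) _ _).symm.trans
    (h z fun _ _ => rfl)

theorem card_compl_le_card_compl_insert (Q : Finset ι) (i : ι) :
    Qᶜ.card ≤ (insert i Q)ᶜ.card + 1 := by
  have h₁ := Finset.card_insert_le i Q
  have h₂ := Finset.card_add_card_compl Q
  have h₃ := Finset.card_add_card_compl (insert i Q)
  omega

/-- A tree must still query every position outside `Q` to which `g` is sensitive at `z`. -/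
theorem card_compl_le_depth_of_sensitive {g : (ι → K) → K} {z : ι → K} (T : TDT ι)
    (Q : Finset ι) (hT : T.AgreesOn g Q z)
    (hz : ∀ i ∉ Q, ∃ v, g (Function.update z i v) ≠ g z) : Qᶜ.card ≤ T.depth := by
  suffices H : ∀ d (T : TDT ι) (Q : Finset ι), T.depth ≤ d → T.AgreesOn g Q z →
      (∀ i ∉ Q, ∃ v, g (Function.update z i v) ≠ g z) → Qᶜ.card ≤ d from
    H _ T Q le_rfl hT hz
  intro d
  induction d with
  | zero =>
    intro T Q hd hT hz
    rcases T with b | ⟨i, t0, tu, t1⟩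
    · simp only [Nat.le_zero, Finset.card_eq_zero, Finset.compl_eq_empty_iff]
      refine Finset.eq_univ_of_forall fun i => ?_
      by_contra hi
      obtain ⟨v, hv⟩ := hz i hi
      exact hv (hT.leaf_eq hi v)
    · simp [depth] at hd
  | succ d ih =>
    intro T Q hd hT hz
    rcases T with b | ⟨i, t0, tu, t1⟩
    · exact (ih (leaf b) Q (Nat.zero_le _) hT hz).trans (Nat.le_succ d)
    · refine (card_compl_le_card_compl_insert Q i).trans (Nat.succ_le_succ ?_)
      refine ih _ _ ?_ hT.child fun j hj => hz j fun h => hj (Finset.mem_insert_of_mem h)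
      have := depth_child_lt i t0 tu t1 (z i)
      omega

end TDT

section Multiplexer

variable {n : ℕ}

/-- The input with unstable selectors and all data bits zero. -/
def muxZero (n : ℕ) : (Fin n ⊕ (Fin n → Bool)) → K
  | .inl _ => none
  | .inr _ => some false

/-- The input with unstable selectors whose only nonzero data bit is at the address `a`. -/
def muxSingle (a : Fin n → Bool) : (Fin n ⊕ (Fin n → Bool)) → K :=
  Function.update (muxZero n) (.inr a) (some true)

theorem hfExt_muxZero : hfExt (MUX n) (muxZero n) = some false := by
  rw [hfExt_eq_some_false_iff]
  intro x hx
  simpa [muxZero, MUX] using hx (.inr fun i => x (.inl i))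

theorem hfExt_muxSingle_ne (a : Fin n → Bool) :
    hfExt (MUX n) (muxSingle a) ≠ some false := by
  rw [Ne, hfExt_eq_some_false_iff]
  intro h
  have := h (Sum.elim a fun b => decide (b = a)) ?_
  · simp [MUX] at this
  · rintro (i | b)
    · exact .inl (by simp [muxSingle, muxZero])
    · by_cases hb : b = a
      · subst hb; simp [muxSingle]
      · simp [muxSingle, muxZero, hb]

theorem hfExt_update_muxSingle (a : Fin n → Bool) (i : Fin n) :
    hfExt (MUX n) (Function.update (muxSingle a) (.inl i) (some !a i)) = some false := by
  rw [hfExt_eq_some_false_iff]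
  intro x hx
  have hi : x (.inl i) = !a i := by simpa [eq_comm] using hx (.inl i)
  have hne : (fun j => x (.inl j)) ≠ a := by
    intro h
    have := congrFun h i
    simp [hi] at this
  simpa [muxSingle, muxZero, MUX, hne] using hx (.inr fun j => x (.inl j))

/-- As long as some data bit is unqueried and all responses agree with `muxZero`, every remaining
position can be forced to be queried. -/
theorem card_compl_le_depth_of_agreesOn_muxZero (T : TDT (Fin n ⊕ (Fin n → Bool)))
    (Q : Finset (Fin n ⊕ (Fin n → Bool))) (hT : T.AgreesOn (hfExt (MUX n)) Q (muxZero n))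
    (hQ : ∃ a, .inr a ∉ Q) : Qᶜ.card ≤ T.depth := by
  suffices H : ∀ d (T : TDT (Fin n ⊕ (Fin n → Bool))) (Q : Finset (Fin n ⊕ (Fin n → Bool))),
      T.depth ≤ d → T.AgreesOn (hfExt (MUX n)) Q (muxZero n) → (∃ a, .inr a ∉ Q) → Qᶜ.card ≤ d from
    H _ T Q le_rfl hT hQ
  intro d
  induction d with
  | zero =>
    rintro (b | ⟨i, t0, tu, t1⟩) Q hd hT ⟨a, ha⟩
    · exact absurd ((hT.leaf_eq ha (some true)).trans hfExt_muxZero) (hfExt_muxSingle_ne a)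
    · simp [TDT.depth] at hd
  | succ d ih =>
    rintro (b | ⟨i, t0, tu, t1⟩) Q hd hT hQ
    · exact (ih (.leaf b) Q (Nat.zero_le _) hT hQ).trans (Nat.le_succ d)
    by_cases hQi : ∃ a, .inr a ∉ insert i Q
    · refine (TDT.card_compl_le_card_compl_insert Q i).trans (Nat.succ_le_succ ?_)
      refine ih _ _ ?_ hT.child hQi
      have := TDT.depth_child_lt i t0 tu t1 (muxZero n i)
      omega
    · push Not at hQi
      obtain ⟨a, ha⟩ := hQ
      obtain rfl : .inr a = i := (Finset.mem_insert.mp (hQi a)).resolve_right ha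
      have hT' : (TDT.node (.inr a) t0 tu t1).AgreesOn (hfExt (MUX n)) Q (muxSingle a) :=
        hT.congr fun j hj => Function.update_of_ne (ne_of_mem_of_not_mem hj ha) _ _
      have h := TDT.card_compl_le_depth_of_sensitive _ _ hT'.child ?_
      · have h₁ := TDT.card_compl_le_card_compl_insert Q (.inr a)
        have h₂ := TDT.depth_child_lt (.inr a) t0 tu t1 (muxSingle a (.inr a))
        omega
      · rintro (i | b) hi
        · refine ⟨some !a i, ?_⟩
          rw [hfExt_update_muxSingle]
          exact (hfExt_muxSingle_ne a).symm
        · exact absurd (hQi b) hi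

end Multiplexer

/-- the hazard-free decision tree depth of `MUX n` is exactly `2^n + n`. -/
theorem mux_hazard_free_depth (n : ℕ) (hn : 1 ≤ n) :
    IsLeast {d : ℕ | ∃ T : TDT (Fin n ⊕ (Fin n → Bool)),
      ComputesHF (MUX n) T ∧ T.depth = d} (2 ^ n + n) := by
  have hcard : Fintype.card (Fin n ⊕ (Fin n → Bool)) = 2 ^ n + n := by
    simp [add_comm]
  constructor
  · refine ⟨TDT.queryAll (hfExt (MUX n)) Finset.univ.toList fun _ => none, fun x => ?_, ?_⟩
    · simp [TDT.eval_queryAll]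
    · rw [TDT.depth_queryAll, Finset.length_toList, Finset.card_univ, hcard]
  · rintro d ⟨T, hT, rfl⟩
    have := card_compl_le_depth_of_agreesOn_muxZero T ∅ (fun y _ => hT y)
      ⟨fun _ => false, by simp⟩
    rwa [Finset.compl_empty, Finset.card_univ, hcard] at this

end HF
end

section
/- For every n ≥ 1 and every k with 0 ≤ k ≤ n, every k-bit hazard-free decision tree for MUX_n has depth at least 2^k + n, and there exists a k-bit hazard-free decision tree for MUX_n of depth exactly 2^k + n; hence the optimal depth of a k-bit hazard-free decision tree for MUX_n is 2^k + n. -/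
namespace HF

variable {ι : Type} [Fintype ι] [DecidableEq ι]

/-- The set of positions queried by a ternary decision tree on a given input. -/
def TDT.queried : TDT ι → (ι → K) → Finset ι
  | .leaf _, _ => ∅
  | .node i t0 tu t1, x => insert i
    (match x i with
    | some false => queried t0 x
    | none => queried tu x
    | some true => queried t1 x)

omit [Fintype ι] in
theorem TDT.card_queried_le_depth (T : TDT ι) (x : ι → K) :
    (T.queried x).card ≤ T.depth := by
  induction T with
  | leaf b => simp [queried]
  | node i t0 tu t1 h0 hu h1 =>
    refine (Finset.card_insert_le _ _).trans ?_
    rw [depth]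
    rcases x i with _ | _ | _ <;> simp only <;> omega

omit [Fintype ι] in
theorem TDT.eval_congr_of_queried (T : TDT ι) {x y : ι → K}
    (h : ∀ i ∈ T.queried x, y i = x i) : T.eval y = T.eval x := by
  induction T with
  | leaf b => rfl
  | node i t0 tu t1 h0 hu h1 =>
    have hi : y i = x i := h i (Finset.mem_insert_self _ _)
    have h' := fun j hj => h j (Finset.mem_insert_of_mem hj)
    rw [eval, eval, hi]
    rcases hx : x i with _ | _ | _ <;> simp only [hx] at h' ⊢
    · exact hu h'
    · exact h0 h'
    · exact h1 h'

omit [Fintype ι] in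
/-- Of a nonempty set of queried positions, one is queried last, and changing its value
keeps the whole set queried. -/
theorem TDT.exists_last_queried (T : TDT ι) (x : ι → K) (D : Finset ι) (hD : D.Nonempty)
    (hDx : D ⊆ T.queried x) :
    ∃ a ∈ D, ∀ y : ι → K, (∀ i, i ≠ a → y i = x i) → D ⊆ T.queried y := by
  induction T generalizing D with
  | leaf b =>
    obtain ⟨a, ha⟩ := hD
    simpa [queried] using hDx ha
  | node i t0 tu t1 h0 hu h1 =>
    rcases (D.erase i).eq_empty_or_nonempty with he | hne
    · have hDi : D = {i} := by
        rcases Finset.erase_eq_empty_iff _ _ |>.1 he with h | h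
        · exact absurd h hD.ne_empty
        · exact h
      subst hDi
      exact ⟨i, by simp, fun y _ => by simp [queried]⟩
    · rw [queried, Finset.subset_insert_iff] at hDx
      have key : ∀ t : TDT ι, (∃ a ∈ D.erase i, ∀ y : ι → K, (∀ j, j ≠ a → y j = x j) →
          D.erase i ⊆ t.queried y) → ∃ a ∈ D, ∀ y : ι → K, (∀ j, j ≠ a → y j = x j) →
          y i = x i ∧ D.erase i ⊆ t.queried y := by
        rintro t ⟨a, ha, hay⟩
        exact ⟨a, Finset.mem_of_mem_erase ha, fun y hy =>
          ⟨hy i (Finset.ne_of_mem_erase ha).symm, hay y hy⟩⟩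
      simp only [queried, Finset.subset_insert_iff]
      rcases hx : x i with _ | _ | _ <;> simp only [hx] at hDx key
      · obtain ⟨a, ha, hay⟩ := key tu (hu _ hne hDx)
        exact ⟨a, ha, fun y hy => by rw [(hay y hy).1]; exact (hay y hy).2⟩
      · obtain ⟨a, ha, hay⟩ := key t0 (h0 _ hne hDx)
        exact ⟨a, ha, fun y hy => by rw [(hay y hy).1]; exact (hay y hy).2⟩
      · obtain ⟨a, ha, hay⟩ := key t1 (h1 _ hne hDx)
        exact ⟨a, ha, fun y hy => by rw [(hay y hy).1]; exact (hay y hy).2⟩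

theorem hfExt_eq_some_iff (f : (ι → Bool) → Bool) (y : ι → K) (b : Bool) :
    hfExt f y = some b ↔ ∀ x, Resolves y x → f x = b := by
  have hres : Resolves y fun i => (y i).getD false := fun i => by
    rcases hy : y i with _ | _ <;> simp [hy]
  unfold hfExt
  split_ifs with h1 h2
  · cases b
    · simpa using ⟨_, hres, h1 _ hres⟩
    · simpa using h1
  · cases b
    · simpa using h2
    · simpa using ⟨_, hres, h2 _ hres⟩
  · cases b
    · simpa using h2
    · simpa using h1

theorem hfExt_congr {f : (ι → Bool) → Bool} {y y' : ι → K}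
    (h : ∀ b, (∃ x, Resolves y x ∧ f x = b) ↔ ∃ x, Resolves y' x ∧ f x = b) :
    hfExt f y = hfExt f y' := by
  have key : ∀ b, (∀ x, Resolves y x → f x = b) ↔ ∀ x, Resolves y' x → f x = b := fun b => by
    have := not_congr (h !b)
    simpa [not_exists, Bool.eq_not] using this
  simp only [hfExt, key]

theorem card_resolves (p : ι → K) :
    (Finset.univ.filter fun a : ι → Bool => Resolves p a).card = 2 ^ numU p := by
  have : (Finset.univ.filter fun a : ι → Bool => Resolves p a) =
      Fintype.piFinset fun i => (p i).elim Finset.univ fun b => {b} := by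
    ext a
    rw [Finset.mem_filter_univ, Fintype.mem_piFinset]
    refine forall_congr' fun i => ?_
    rcases p i with _ | b
    · simp
    · simpa using eq_comm
  rw [this, Fintype.card_piFinset, numU, Finset.card_filter, ← Finset.prod_pow_eq_pow_sum]
  refine Finset.prod_congr rfl fun i _ => ?_
  rcases p i with _ | b <;> simp

/-- The tree querying all positions of `l` in order, recording the answers on top of `p`, and
continuing with `c` applied to the record. -/
def TDT.queryAll_s1 (c : (ι → K) → TDT ι) : List ι → (ι → K) → TDT ι
  | [], p => c p
  | i :: l, p => .node i (queryAll_s1 c l (Function.update p i (some false)))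
      (queryAll_s1 c l (Function.update p i none)) (queryAll_s1 c l (Function.update p i (some true)))

omit [Fintype ι] in
theorem TDT.eval_queryAll_s1 (c : (ι → K) → TDT ι) (l : List ι) (p x : ι → K) :
    ∃ q, (∀ i ∈ l, q i = x i) ∧ (∀ i ∉ l, q i = p i) ∧
      (queryAll_s1 c l p).eval x = (c q).eval x := by
  induction l generalizing p with
  | nil => exact ⟨p, by simp, fun _ _ => rfl, rfl⟩
  | cons i l ih =>
    obtain ⟨q, hql, hqp, hq⟩ := ih (Function.update p i (x i))
    have hi : (queryAll_s1 c (i :: l) p).eval x =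
        (queryAll_s1 c l (Function.update p i (x i))).eval x := by
      rw [queryAll_s1, eval]
      rcases x i with _ | _ | _ <;> rfl
    refine ⟨q, fun j hj => ?_, fun j hj => ?_, hi.trans hq⟩
    · by_cases hjl : j ∈ l
      · exact hql j hjl
      · have hji : j = i := by simpa [hjl] using hj
        rw [hqp j hjl, hji, Function.update_self]
    · rw [List.mem_cons, not_or] at hj
      simp [hqp j hj.2, hj.1]

omit [Fintype ι] in
theorem TDT.depth_queryAll_le (c : (ι → K) → TDT ι) (d : ℕ) (hd : ∀ p, (c p).depth ≤ d)
    (l : List ι) (p : ι → K) : (queryAll_s1 c l p).depth ≤ d + l.length := by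
  induction l generalizing p with
  | nil => exact hd p
  | cons i l ih =>
    rw [queryAll_s1, depth, List.length_cons, ← add_assoc]
    gcongr
    exact max_le (max_le (ih _) (ih _)) (ih _)

theorem exists_resolves_mux {n : ℕ} {y y' : Fin n ⊕ (Fin n → Bool) → K} {b : Bool}
    (hl : ∀ i, y (Sum.inl i) = y' (Sum.inl i))
    (hr : ∀ a, Resolves (fun i => y' (Sum.inl i)) a → y (Sum.inr a) = y' (Sum.inr a))
    (h : ∃ z, Resolves y z ∧ MUX n z = b) : ∃ z, Resolves y' z ∧ MUX n z = b := by
  obtain ⟨z, hz, hzb⟩ := h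
  set a : Fin n → Bool := fun i => z (Sum.inl i) with ha
  have hzl : Resolves (fun i => y' (Sum.inl i)) a := fun i => by
    simpa only [hl] using hz (Sum.inl i)
  refine ⟨Sum.elim a fun c => if c = a then z (Sum.inr a) else (y' (Sum.inr c)).getD false,
    ?_, by simpa [MUX] using hzb⟩
  rintro (i | c)
  · exact hzl i
  · by_cases hc : c = a
    · subst hc
      simpa [← hr _ hzl] using hz (Sum.inr a)
    · simp only [Sum.elim_inr, if_neg hc]
      rcases y' (Sum.inr c) with _ | _ <;> simp

/-- `hfExt (MUX n)` depends only on the selectors and the data bits they may address. -/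
theorem mux_hfExt_congr {n : ℕ} {y y' : Fin n ⊕ (Fin n → Bool) → K}
    (hl : ∀ i, y (Sum.inl i) = y' (Sum.inl i))
    (hr : ∀ a, Resolves (fun i => y' (Sum.inl i)) a → y (Sum.inr a) = y' (Sum.inr a)) :
    hfExt (MUX n) y = hfExt (MUX n) y' :=
  hfExt_congr fun _ => ⟨exists_resolves_mux hl hr, exists_resolves_mux (fun i => (hl i).symm)
    fun a ha => (hr a (by simpa only [← hl] using ha)).symm⟩

theorem exists_mux_tree (n k : ℕ) : ∃ T : TDT (Fin n ⊕ (Fin n → Bool)),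
    KComputes k (MUX n) T ∧ T.depth ≤ 2 ^ k + n := by
  let data (p : Fin n ⊕ (Fin n → Bool) → K) : Finset (Fin n → Bool) :=
    Finset.univ.filter fun a => Resolves (fun i => p (Sum.inl i)) a
  let c (p : Fin n ⊕ (Fin n → Bool) → K) : TDT (Fin n ⊕ (Fin n → Bool)) :=
    if numU (fun i => p (Sum.inl i)) ≤ k then
      TDT.queryAll_s1 (fun q => .leaf (hfExt (MUX n) q)) ((data p).toList.map Sum.inr) p
    else .leaf none
  have hc : ∀ p, (c p).depth ≤ 2 ^ k := fun p => by
    simp only [c]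
    split_ifs with h
    · refine (TDT.depth_queryAll_le _ 0 (fun _ => le_rfl) _ _).trans ?_
      simp only [List.length_map, Finset.length_toList, zero_add, data, card_resolves]
      exact Nat.pow_le_pow_right two_pos h
    · simp [TDT.depth]
  let l : List (Fin n ⊕ (Fin n → Bool)) := (List.finRange n).map Sum.inl
  refine ⟨TDT.queryAll_s1 c l fun _ => none, fun x hx => ?_, ?_⟩
  · obtain ⟨p, hpl, -, hp⟩ := TDT.eval_queryAll_s1 c l (fun _ => none) x
    replace hpl : ∀ i, p (Sum.inl i) = x (Sum.inl i) := fun i => hpl _ (by simp [l])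
    have hU : numU (fun i => p (Sum.inl i)) ≤ k := by
      simp only [hpl]
      refine le_trans ?_ hx
      refine Finset.card_le_card_of_injOn Sum.inl (fun i hi => ?_) Sum.inl_injective.injOn
      simpa using hi
    obtain ⟨q, hqd, hqp, hq⟩ := TDT.eval_queryAll_s1 (fun q => .leaf (hfExt (MUX n) q))
      ((data p).toList.map Sum.inr) p x
    simp only [hp, c, if_pos hU]
    rw [hq, TDT.eval]
    refine mux_hfExt_congr (fun i => (hqp _ (by simp)).trans (hpl i)) fun a ha => hqd _ ?_
    simpa [data, hpl] using ha
  · have := TDT.depth_queryAll_le c _ hc l fun _ => none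
    simpa [l] using this

theorem numU_sumElim_le {α β : Type} [Fintype α] [Fintype β] [DecidableEq α] [DecidableEq β]
    (σ : α → K) (g : β → K) (hg : ∀ b, g b ≠ none) : numU (Sum.elim σ g) ≤ numU σ := by
  refine (Finset.card_le_card (t := (Finset.univ.filter fun i => σ i = none).image Sum.inl)
    fun j hj => ?_).trans Finset.card_image_le
  rcases j with i | b
  · simpa using hj
  · simp [hg b] at hj

theorem mux_hfExt_zero {n : ℕ} (σ : Fin n → K) :
    hfExt (MUX n) (Sum.elim σ fun _ => some false) = some false := by
  rw [hfExt_eq_some_iff]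
  intro z hz
  rcases hz (Sum.inr fun i => z (Sum.inl i)) with h | h
  · simp at h
  · exact (Option.some.inj h).symm

theorem mux_hfExt_update_ne {n : ℕ} (σ : Fin n → K) {a : Fin n → Bool} (ha : Resolves σ a) :
    hfExt (MUX n) (Sum.elim σ (Function.update (fun _ => some false) a (some true))) ≠
      some false := by
  rw [Ne, hfExt_eq_some_iff]
  intro h
  have := h (Sum.elim a fun c => decide (c = a)) ?_
  · simp [MUX] at this
  · rintro (i | c)
    · exact ha i
    · by_cases hc : c = a
      · simp [hc]
      · simp [hc]

theorem mux_hfExt_update_eq {n : ℕ} (σ : Fin n → K) {a : Fin n → Bool} (ha : ¬ Resolves σ a) :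
    hfExt (MUX n) (Sum.elim σ (Function.update (fun _ => some false) a (some true))) =
      some false := by
  refine Eq.trans ?_ (mux_hfExt_zero σ)
  refine mux_hfExt_congr (fun _ => rfl) fun c hc => ?_
  have : c ≠ a := fun h => ha (h ▸ hc)
  simp [this]

/-- On an input with all data bits zero, a correct tree queries every data bit that some input
consistent with the queried selectors may address. -/
theorem KComputes.mem_queried_of_resolves {n k : ℕ} {T : TDT (Fin n ⊕ (Fin n → Bool))}
    (hT : KComputes k (MUX n) T) {x : Fin n ⊕ (Fin n → Bool) → K}
    (hx : ∀ c, x (Sum.inr c) = some false) {σ : Fin n → K} (hσ : numU σ ≤ k)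
    (hσx : ∀ i, Sum.inl i ∈ T.queried x → σ i = x (Sum.inl i)) {a : Fin n → Bool}
    (ha : Resolves σ a) : Sum.inr a ∈ T.queried x := by
  by_contra hq
  have h0 : T.eval (Sum.elim σ fun _ => some false) = T.eval x :=
    T.eval_congr_of_queried fun j hj => by
      rcases j with i | c
      · exact hσx i hj
      · exact (hx c).symm
  have h1 : T.eval (Sum.elim σ (Function.update (fun _ => some false) a (some true))) =
      T.eval x :=
    T.eval_congr_of_queried fun j hj => by
      rcases j with i | c
      · exact hσx i hj
      · have : c ≠ a := fun h => hq (h ▸ hj)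
        simp [this, hx]
  apply mux_hfExt_update_ne σ ha
  rw [← hT _ ((numU_sumElim_le _ _ fun b => ?_).trans hσ), h1, ← h0,
    hT _ ((numU_sumElim_le _ _ fun b => by simp).trans hσ), mux_hfExt_zero]
  by_cases hb : b = a <;> simp [hb]

/-- The input whose unstable bits are exactly the positions of `V` on the left, all other bits
being zero. -/
def unstableOn {α : Type} (β : Type) [DecidableEq α] (V : Finset α) : α ⊕ β → K :=
  Sum.elim (fun i => if i ∈ V then none else some false) fun _ => some false

/-- Answering `u` to the first `k` queries of left positions, and zero to every other query. -/
theorem TDT.exists_unstableOn {α β : Type} [DecidableEq α] [DecidableEq β] (T : TDT (α ⊕ β))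
    (k : ℕ) (U : Finset α) (hU : U.card ≤ k) :
    ∃ V, U ⊆ V ∧ V.card ≤ k ∧ (∀ i ∈ V, i ∈ U ∨ Sum.inl i ∈ T.queried (unstableOn β V)) ∧
      (V.card = k ∨ ∀ i, Sum.inl i ∈ T.queried (unstableOn β V) → i ∈ V) := by
  induction T generalizing U with
  | leaf b => exact ⟨U, subset_rfl, hU, fun i hi => Or.inl hi, Or.inr (by simp [queried])⟩
  | node j t0 tu t1 h0 hu h1 =>
    rcases hU.eq_or_lt with h | h
    · exact ⟨U, subset_rfl, hU, fun i hi => Or.inl hi, Or.inl h⟩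
    rcases j with i | b
    · obtain ⟨V, hUV, hVk, hV, hQ⟩ := hu (insert i U) ((Finset.card_insert_le _ _).trans h)
      have hiV : i ∈ V := hUV (Finset.mem_insert_self _ _)
      have hi : unstableOn β V (Sum.inl i) = none := by simp [unstableOn, hiV]
      refine ⟨V, (Finset.subset_insert _ _).trans hUV, hVk, fun i' hi' => ?_,
        hQ.imp_right fun hQ i' => ?_⟩
      · have := hV i' hi'
        simp only [queried, hi, Finset.mem_insert, Sum.inl.injEq] at this ⊢
        tauto
      · simp only [queried, hi, Finset.mem_insert, Sum.inl.injEq]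
        rintro (rfl | h)
        · exact hiV
        · exact hQ _ h
    · obtain ⟨V, hUV, hVk, hV, hQ⟩ := h0 U hU
      have hb : unstableOn β V (Sum.inr b) = some false := rfl
      refine ⟨V, hUV, hVk, ?_, ?_⟩ <;> simpa [queried, hb]

theorem mux_le_depth_of_lt {n k : ℕ} (hk : k < n) {T : TDT (Fin n ⊕ (Fin n → Bool))}
    (hT : KComputes k (MUX n) T) : 2 ^ k + n ≤ T.depth := by
  obtain ⟨V, -, hVk, hV, hQ⟩ := T.exists_unstableOn k ∅ (by simp)
  set x : Fin n ⊕ (Fin n → Bool) → K := unstableOn _ V with hx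
  let A : Finset (Fin n) := Finset.univ.filter fun i => Sum.inl i ∈ T.queried x
  have hVA : V ⊆ A := fun i hi => by simpa [A] using hV i hi
  let p : Fin n → K := fun i => if i ∈ A \ V then some false else none
  have hp : numU p + (A.card - V.card) = n := by
    rw [← Finset.card_sdiff_of_subset hVA]
    have : (Finset.univ.filter fun i => p i = none) = (A \ V)ᶜ := by
      ext i
      simp [p]
    rw [numU, this, Finset.card_compl_add_card, Fintype.card_fin]
  have hsub : A.disjSum (Finset.univ.filter fun a : Fin n → Bool => Resolves p a) ⊆
      T.queried x := by
    rintro (i | a) h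
    · simpa [A] using h
    · have ha : Resolves p a := by simpa using h
      refine hT.mem_queried_of_resolves (σ := fun i => if i ∈ V then none else some (a i))
        (fun c => rfl) (by simpa [numU] using hVk) (fun i hi => ?_) fun i => ?_
      · by_cases hiV : i ∈ V
        · simp [hx, unstableOn, hiV]
        · have hpi := ha i
          have hiA : i ∈ A := by simpa [A] using hi
          simp only [p, Finset.mem_sdiff, hiA, hiV, not_false_eq_true, and_self, if_true,
            reduceCtorEq, false_or] at hpi
          simp [hx, unstableOn, hiV, hpi]
      · by_cases hiV : i ∈ V <;> simp [hiV]
  have hcard := (Finset.card_le_card hsub).trans (T.card_queried_le_depth x)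
  rw [Finset.card_disjSum, card_resolves] at hcard
  refine le_trans ?_ hcard
  have hVAc := Finset.card_le_card hVA
  have hAn : A.card ≤ n := by simpa using Finset.card_le_univ A
  rcases hQ with h | h
  · have hm : numU p = k + (n - A.card) := by omega
    have h1 := Nat.lt_two_pow_self (n := n - A.card)
    have h2 := Nat.one_le_two_pow (n := k)
    have h3 : 2 ^ k * (n - A.card + 1) ≤ 2 ^ k * 2 ^ (n - A.card) := Nat.mul_le_mul_left _ h1
    have h4 : n - A.card ≤ 2 ^ k * (n - A.card) := Nat.le_mul_of_pos_left _ h2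
    rw [hm, pow_add]
    rw [mul_add, mul_one] at h3
    omega
  · have hAV : A ⊆ V := fun i hi => h i (by simpa [A] using hi)
    have := Finset.card_le_card hAV
    have hm : numU p = (n - 1) + 1 := by omega
    have h1 := Nat.lt_two_pow_self (n := n - 1)
    have h2 : 2 ^ k ≤ 2 ^ (n - 1) := Nat.pow_le_pow_right two_pos (by omega)
    rw [hm, pow_succ]
    omega

theorem mux_le_depth_self {n : ℕ} {T : TDT (Fin n ⊕ (Fin n → Bool))}
    (hT : KComputes n (MUX n) T) : 2 ^ n + n ≤ T.depth := by
  have hU (σ : Fin n → K) : numU σ ≤ n :=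
    (Finset.card_le_univ _).trans_eq (Fintype.card_fin n)
  obtain ⟨a, ha, hay⟩ := T.exists_last_queried
    (Sum.elim (fun _ => none) fun _ => some false) (Finset.univ.image Sum.inr)
    (Finset.univ_nonempty.image _) fun j hj => by
      obtain ⟨c, -, rfl⟩ := Finset.mem_image.1 hj
      exact hT.mem_queried_of_resolves (σ := fun _ => none) (fun _ => rfl) (hU _)
        (fun _ _ => rfl) fun _ => Or.inl rfl
  obtain ⟨a, -, rfl⟩ := Finset.mem_image.1 ha
  let g : (Fin n → Bool) → K := Function.update (fun _ => some false) a (some true)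
  have hg : ∀ c, g c ≠ none := fun c => by
    by_cases hc : c = a <;> simp [g, hc]
  set y : Fin n ⊕ (Fin n → Bool) → K := Sum.elim (fun _ => none) g with hy
  have hdata := hay y fun j hj => by
    rcases j with i | c
    · rfl
    · have : c ≠ a := fun h => hj (h ▸ rfl)
      simp only [hy, g, Sum.elim_inr, Function.update_of_ne this]
  have hQ : T.queried y = Finset.univ := by
    rw [Finset.eq_univ_iff_forall]
    rintro (i | c)
    · by_contra hi
      let σ : Fin n → K := Function.update (fun _ => none) i (some !a i)
      have he : T.eval (Sum.elim σ g) = T.eval y := T.eval_congr_of_queried fun j hj => by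
        rcases j with i' | c
        · have : i' ≠ i := fun h => hi (h ▸ hj)
          simp [hy, σ, this]
        · rfl
      have hσ : ¬ Resolves σ a := fun h => by simpa [σ] using h i
      apply mux_hfExt_update_ne (fun _ => none) (a := a) fun _ => Or.inl rfl
      refine Eq.trans ?_ (mux_hfExt_update_eq σ hσ)
      rw [← hT _ ((numU_sumElim_le _ _ hg).trans (hU _)),
        ← hT _ ((numU_sumElim_le _ _ hg).trans (hU _)), he]
    · exact hdata (by simp)
  have := T.card_queried_le_depth y
  rw [hQ] at this
  simpa [add_comm] using this

/-- the optimal depth of a `k`-bit hazard-free decision tree for `MUX n`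
is exactly `2^k + n`, for `0 ≤ k ≤ n`. -/
theorem mux_kbit_depth (n k : ℕ) (hn : 1 ≤ n) (hk : k ≤ n) :
    IsLeast {d : ℕ | ∃ T : TDT (Fin n ⊕ (Fin n → Bool)),
      KComputes k (MUX n) T ∧ T.depth = d} (2 ^ k + n) := by
  have lower : ∀ T : TDT (Fin n ⊕ (Fin n → Bool)), KComputes k (MUX n) T →
      2 ^ k + n ≤ T.depth := fun T hT => by
    rcases hk.lt_or_eq with h | rfl
    · exact mux_le_depth_of_lt h hT
    · exact mux_le_depth_self hT
  obtain ⟨T, hT, hd⟩ := exists_mux_tree n k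
  refine ⟨⟨T, hT, hd.antisymm (lower T hT)⟩, ?_⟩
  rintro _ ⟨T, hT, rfl⟩
  exact lower T hT

end HF
end

section
/- For every n ≥ 1, the minimum number of leaves of a hazard-free decision tree computing the n-input AND function equals 2^{n+1} − 1, i.e., size_u(AND_n) = 2^{n+1} − 1, where AND_n(x_1,…,x_n) = x_1 ∧ … ∧ x_n. -/
namespace HF

variable {ι : Type} [Fintype ι] [DecidableEq ι]

theorem hfExt_ANDf (n : ℕ) (y : Fin n → K) :
    hfExt (ANDf n) y =
      if ∃ i, y i = some false then some false
      else if ∃ i, y i = none then none else some true := by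
  have resolves_getD (b : Bool) : Resolves y fun i => (y i).getD b := by
    intro i
    cases h : y i <;> simp [h]
  unfold hfExt
  by_cases h0 : ∃ i, y i = some false
  · obtain ⟨i, hi⟩ := h0
    have key : ∀ x, Resolves y x → ANDf n x = false := by
      intro x hx
      have hxi : x i = false := by
        have := hx i
        simp_all
      simp only [ANDf, decide_eq_false_iff_not]
      exact fun h => by simp [h i] at hxi
    rw [if_neg, if_pos key, if_pos ⟨i, hi⟩]
    intro h
    have hr := resolves_getD true
    exact Bool.false_ne_true ((key _ hr).symm.trans (h _ hr))
  · rw [if_neg h0]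
    push Not at h0
    have htrue : ANDf n (fun i => (y i).getD true) = true := by
      simp only [ANDf, decide_eq_true_eq]
      intro i
      have := h0 i
      rcases h : y i with _ | _ | _ <;> simp_all
    by_cases h1 : ∃ i, y i = none
    · rw [if_pos h1, if_neg, if_neg]
      · intro h
        simpa [htrue] using h _ (resolves_getD true)
      · intro h
        obtain ⟨i, hi⟩ := h1
        have := h _ (resolves_getD false)
        simp only [ANDf, decide_eq_true_eq] at this
        simpa [hi] using this i
    · rw [if_neg h1, if_pos]
      intro x hx
      simp only [ANDf, decide_eq_true_eq]
      intro i
      have h0i := h0 i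
      rcases hx i with h | h
      · exact absurd ⟨i, h⟩ h1
      · simpa [h] using h0i

namespace TDT

/-- The tree querying the positions of a list in order, stopping with value `0` at the first `0`;
it outputs `u` if some response was `u` and no response was `0`, and `b` if all were `1`. -/
def andList {α : Type} : List α → K → TDT α
  | [], b => leaf b
  | i :: l, b => node i (leaf (some false)) (andList l none) (andList l b)

theorem size_andList {α : Type} (l : List α) (b : K) :
    (andList l b).size + 1 = 2 ^ (l.length + 1) := by
  induction l generalizing b with
  | nil => rfl
  | cons i l ih =>
    have h1 := ih none
    have h2 := ih b
    simp only [andList, size, List.length_cons]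
    rw [pow_succ]
    omega

theorem eval_andList {α : Type} [Fintype α] [DecidableEq α] (l : List α) (b : K) (x : α → K) :
    (andList l b).eval x =
      if ∃ i ∈ l, x i = some false then some false
      else if ∃ i ∈ l, x i = none then none else b := by
  induction l generalizing b with
  | nil => simp [andList, eval]
  | cons i l ih =>
    rcases h : x i with _ | _ | _ <;> simp [andList, eval, ih, h]

theorem one_le_size {α : Type} (T : TDT α) : 1 ≤ T.size := by
  induction T with
  | leaf => exact le_rfl
  | node => simp only [size]; omega

/-- A tree that detects zeros among the positions of `S`, once the remaining positions are fixed
to nonzero values, has at least `2 ^ (#S + 1) - 1` leaves. -/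
theorem two_pow_card_le_size_add_one {α : Type} [Fintype α] [DecidableEq α] (T : TDT α)
    (S : Finset α) (x : α → K) (hx : ∀ i ∉ S, x i ≠ some false)
    (hT : ∀ y : α → K, (∀ i ∉ S, y i = x i) →
      (T.eval y = some false ↔ ∃ i, y i = some false)) :
    2 ^ (S.card + 1) ≤ T.size + 1 := by
  induction T generalizing S x with
  | leaf b =>
    have hS : S = ∅ := by
      by_contra hne
      obtain ⟨i, hi⟩ := Finset.nonempty_iff_ne_empty.mpr hne
      have h0 := hT (fun j => if j ∈ S then some false else x j) (by simp +contextual)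
      have h1 := hT (fun j => if j ∈ S then none else x j) (by simp +contextual)
      have hb : b = some false := h0.mpr ⟨i, by simp [hi]⟩
      obtain ⟨j, hj⟩ := h1.mp hb
      by_cases hjS : j ∈ S
      · simp [hjS] at hj
      · exact hx j hjS (by simpa [hjS] using hj)
    simp [hS, size]
  | node i t0 tu t1 ih0 ihu ih1 =>
    by_cases hi : i ∈ S
    · have fixed (v : K) (hv : v ≠ some false) :
          ∀ j ∉ S.erase i, Function.update x i v j ≠ some false := by
        intro j hj
        by_cases hji : j = i
        · subst hji; simpa using hv
        · simpa [hji] using hx j (by simpa [hji] using hj)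
      have agree (v : K) (y : α → K) (hy : ∀ j ∉ S.erase i, y j = Function.update x i v j) :
          y i = v ∧ ∀ j ∉ S, y j = x j := by
        refine ⟨by simpa using hy i (by simp), fun j hj => ?_⟩
        have hji : j ≠ i := fun h => hj (h ▸ hi)
        simpa [hji] using hy j (by simp [hj])
      have hu := ihu (S.erase i) (Function.update x i none) (fixed _ (by simp)) fun y hy => by
        obtain ⟨h, h'⟩ := agree _ y hy
        simpa [eval, h] using hT y h'
      have h1 := ih1 (S.erase i) (Function.update x i (some true)) (fixed _ (by simp))
        fun y hy => by
          obtain ⟨h, h'⟩ := agree _ y hy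
          simpa [eval, h] using hT y h'
      have h0 := one_le_size t0
      rw [Finset.card_erase_add_one hi] at hu h1
      rw [pow_succ]
      simp only [size]
      omega
    · simp only [size]
      rcases h : x i with _ | _ | _
      · have := ihu S x hx fun y hy => by simpa [eval, hy i hi, h] using hT y hy
        omega
      · exact absurd h (hx i hi)
      · have := ih1 S x hx fun y hy => by simpa [eval, hy i hi, h] using hT y hy
        omega

end TDT

/-- `size_u(AND_n) = 2^{n+1} − 1`. -/
theorem and_hazard_free_size (n : ℕ) (hn : 1 ≤ n) :
    IsLeast {s : ℕ | ∃ T : TDT (Fin n), ComputesHF (ANDf n) T ∧ T.size = s}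
      (2 ^ (n + 1) - 1) := by
  constructor
  · refine ⟨TDT.andList (List.finRange n) (some true), fun x => ?_, ?_⟩
    · simp [TDT.eval_andList, hfExt_ANDf]
    · have := TDT.size_andList (List.finRange n) (some true)
      rw [List.length_finRange] at this
      omega
  · rintro s ⟨T, hT, rfl⟩
    have := T.two_pow_card_le_size_add_one Finset.univ (fun _ => none) (by simp) fun y _ => by
      rw [hT y, hfExt_ANDf]
      split_ifs <;> simp_all
    rw [Finset.card_univ, Fintype.card_fin] at this
    omega

end HF
end

section
/- For every n ≥ 1, there exists a non-degenerate Boolean function on N = n + 2^{n+1} − 1 inputs that is computed by a hazard-free decision tree of depth 2n + 1; in particular depth_u of this function is at most 2n + 1. -/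
namespace HF

variable {ι : Type} [Fintype ι] [DecidableEq ι]

theorem exists_resolves {κ : Type} (y : κ → K) : ∃ x, Resolves y x :=
  ⟨fun i => (y i).getD false, fun i => by cases h : y i <;> simp [h]⟩

theorem computesHF_iff (f : (ι → Bool) → Bool) (T : TDT ι) :
    ComputesHF f T ↔ ∀ y b, T.eval y = some b ↔ ∀ x, Resolves y x → f x = b := by
  simp only [← hfExt_eq_some_iff]
  exact ⟨fun h y b => by rw [h y], fun h y => Option.ext (h y)⟩

namespace TDT

/-- Relabel the queried positions of a tree. -/
def rename {ι κ : Type} (φ : ι → κ) : TDT ι → TDT κ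
  | .leaf b => .leaf b
  | .node i t0 tu t1 => .node (φ i) (t0.rename φ) (tu.rename φ) (t1.rename φ)

theorem depth_rename {ι κ : Type} (φ : ι → κ) (T : TDT ι) : (T.rename φ).depth = T.depth := by
  induction T with
  | leaf b => rfl
  | node i t0 tu t1 h0 hu h1 => simp only [rename, depth, h0, hu, h1]

theorem eval_rename {ι κ : Type} (φ : ι → κ) (T : TDT ι) (y : κ → K) :
    (T.rename φ).eval y = T.eval (y ∘ φ) := by
  induction T with
  | leaf b => rfl
  | node i t0 tu t1 h0 hu h1 => simp only [rename, eval, h0, hu, h1, Function.comp_apply]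

/-- Replace every leaf label other than `some b` by `none`. -/
def clamp {ι : Type} (b : Bool) : TDT ι → TDT ι
  | .leaf c => .leaf (if c = some b then c else none)
  | .node i t0 tu t1 => .node i (t0.clamp b) (tu.clamp b) (t1.clamp b)

theorem depth_clamp {ι : Type} (b : Bool) (T : TDT ι) : (T.clamp b).depth = T.depth := by
  induction T with
  | leaf c => rfl
  | node i t0 tu t1 h0 hu h1 => simp only [clamp, depth, h0, hu, h1]

theorem eval_clamp_eq_some_iff {ι : Type} (b c : Bool) (T : TDT ι) (y : ι → K) :
    (T.clamp b).eval y = some c ↔ b = c ∧ T.eval y = some c := by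
  induction T with
  | leaf k =>
    simp only [clamp, eval]
    grind
  | node i t0 tu t1 h0 hu h1 =>
    simp only [clamp, eval]
    split <;> assumption

end TDT

theorem ComputesHF.rename {κ : Type} [Fintype κ] [DecidableEq κ] {f : (ι → Bool) → Bool}
    {T : TDT ι} (hT : ComputesHF f T) {φ : ι → κ} (hφ : Function.Injective φ) :
    ComputesHF (fun z => f (z ∘ φ)) (T.rename φ) := by
  rw [computesHF_iff] at hT ⊢
  intro y b
  rw [TDT.eval_rename, hT]
  refine ⟨fun h z hz => h _ fun i => hz (φ i), fun h x hx => ?_⟩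
  obtain ⟨w, hw⟩ := exists_resolves y
  have := h (Function.extend φ x w) fun k => by
    by_cases hk : ∃ i, φ i = k
    · obtain ⟨i, rfl⟩ := hk
      rw [hφ.extend_apply]
      exact hx i
    · rw [Function.extend_apply' _ _ _ hk]
      exact hw k
  rwa [Function.extend_comp hφ] at this

/-- The four-way selection `(0,0) ↦ 0`, `(0,1) ↦ a`, `(1,0) ↦ b`, `(1,1) ↦ 1`. -/
def select : Bool → Bool → Bool → Bool → Bool
  | false, false, _, _ => false
  | false, true, a, _ => a
  | true, false, _, b => b
  | true, true, _, _ => true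

theorem Resolves.update {κ : Type} [DecidableEq κ] {y : κ → K} {x : κ → Bool} (hx : Resolves y x)
    {i : κ} {b : Bool} (hb : y i = none ∨ y i = some b) :
    Resolves y (Function.update x i b) := by
  intro j
  by_cases hj : j = i
  · subst hj
    simpa using hb
  · simpa [hj] using hx j

/-- A tree for the selection, by two selector bits at positions `s` and `e`, among `0`, `1` and
the functions computed by `T0` and `T1`. -/
def selectTree {κ : Type} (s e : κ) (T0 T1 : TDT κ) : TDT κ :=
  .node s (.node e (.leaf (some false)) (T0.clamp false) T0)
    (.node e (T1.clamp false) (.leaf none) (T0.clamp true))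
    (.node e T1 (T1.clamp true) (.leaf (some true)))

theorem depth_selectTree_le {κ : Type} (s e : κ) {T0 T1 : TDT κ} {d : ℕ} (h0 : T0.depth ≤ d)
    (h1 : T1.depth ≤ d) : (selectTree s e T0 T1).depth ≤ d + 2 := by
  simp only [selectTree, TDT.depth, TDT.depth_clamp]
  omega

theorem computesHF_selectTree {s e : ι} (hse : s ≠ e) {f0 f1 : (ι → Bool) → Bool}
    (hs0 : ∀ x b, f0 (Function.update x s b) = f0 x)
    (he0 : ∀ x b, f0 (Function.update x e b) = f0 x)
    (hs1 : ∀ x b, f1 (Function.update x s b) = f1 x)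
    (he1 : ∀ x b, f1 (Function.update x e b) = f1 x)
    {T0 T1 : TDT ι} (hT0 : ComputesHF f0 T0) (hT1 : ComputesHF f1 T1) :
    ComputesHF (fun z => select (z s) (z e) (f0 z) (f1 z)) (selectTree s e T0 T1) := by
  rw [computesHF_iff] at hT0 hT1 ⊢
  intro y b
  have key : (∀ x, Resolves y x → select (x s) (x e) (f0 x) (f1 x) = b) ↔
      ∀ σ ε, (y s = none ∨ y s = some σ) → (y e = none ∨ y e = some ε) →
        ∀ x, Resolves y x → select σ ε (f0 x) (f1 x) = b := by
    refine ⟨fun h σ ε hσ hε x hx => ?_, fun h x hx => h _ _ (hx s) (hx e) x hx⟩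
    have := h _ ((hx.update hσ).update hε)
    simpa [hse, hs0, he0, hs1, he1] using this
  rw [key]
  obtain ⟨x₀, hx₀⟩ := exists_resolves y
  have triv : ∀ c : Bool, (∀ x, Resolves y x → c = b) ↔ c = b :=
    fun c => ⟨fun h => h x₀ hx₀, fun h _ _ => h⟩
  rcases hs : y s with _ | _ | _ <;> rcases he : y e with _ | _ | _ <;>
    simp only [selectTree, TDT.eval, TDT.eval_clamp_eq_some_iff, hs, he, Bool.forall_bool, select, triv,
      hT0 y b, hT1 y b] <;> cases b <;> simp

/-- The step of the construction: two copies of `g` sharing the selectors `S`, with fresh selector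
`inl none` and fresh auxiliary bit `inr none`. -/
def doubling {S T : Type} (g : (S ⊕ T → Bool) → Bool)
    (z : Option S ⊕ Option (T ⊕ T) → Bool) : Bool :=
  select (z (.inl none)) (z (.inr none)) (g (z ∘ Sum.map some (some ∘ Sum.inl)))
    (g (z ∘ Sum.map some (some ∘ Sum.inr)))

theorem Nondegenerate.doubling {S T : Type} {g : (S ⊕ T → Bool) → Bool} (hg : Nondegenerate g)
    (htrue : ∃ x, g x = true) : Nondegenerate (doubling g) := by
  obtain ⟨w, hw⟩ := htrue
  let Z (σ ε : Bool) (a : S → Bool) (t0 t1 : T → Bool) : Option S ⊕ Option (T ⊕ T) → Bool :=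
    Sum.elim (fun o => o.elim σ a) (fun o => o.elim ε (Sum.elim t0 t1))
  have hZ (σ ε a t0 t1) : HF.doubling g (Z σ ε a t0 t1) =
      select σ ε (g (Sum.elim a t0)) (g (Sum.elim a t1)) := by
    unfold HF.doubling
    congr 2 <;> (ext i; rcases i with i | i <;> rfl)
  have hsum (x : S ⊕ T → Bool) : Sum.elim (x ∘ Sum.inl) (x ∘ Sum.inr) = x :=
    Sum.elim_comp_inl_inr x
  rintro ((_ | i) | (_ | (i | i)))
  · refine ⟨Z false false (w ∘ .inl) (w ∘ .inr) (w ∘ .inr),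
      Z true false (w ∘ .inl) (w ∘ .inr) (w ∘ .inr), ?_, by simp [Z], by simp [hZ, select, hsum, hw]⟩
    rintro ((_ | j) | (_ | (j | j))) hj <;> simp_all [Z]
  · obtain ⟨x, y, hxy, hi, hne⟩ := hg (.inl i)
    refine ⟨Z false true (x ∘ .inl) (x ∘ .inr) (x ∘ .inr),
      Z false true (y ∘ .inl) (y ∘ .inr) (y ∘ .inr), ?_, by simpa [Z] using hi,
      by simpa [hZ, select, hsum] using hne⟩
    rintro ((_ | j) | (_ | (j | j))) hj <;> simp_all [Z]
  · refine ⟨Z false false (w ∘ .inl) (w ∘ .inr) (w ∘ .inr),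
      Z false true (w ∘ .inl) (w ∘ .inr) (w ∘ .inr), ?_, by simp [Z], by simp [hZ, select, hsum, hw]⟩
    rintro ((_ | j) | (_ | (j | j))) hj <;> simp_all [Z]
  · obtain ⟨x, y, hxy, hi, hne⟩ := hg (.inr i)
    refine ⟨Z false true (x ∘ .inl) (x ∘ .inr) (w ∘ .inr),
      Z false true (y ∘ .inl) (y ∘ .inr) (w ∘ .inr), ?_, by simpa [Z] using hi,
      by simpa [hZ, select, hsum] using hne⟩
    rintro ((_ | j) | (_ | (j | j))) hj <;> simp_all [Z]
  · obtain ⟨x, y, hxy, hi, hne⟩ := hg (.inr i)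
    refine ⟨Z true false (x ∘ .inl) (w ∘ .inr) (x ∘ .inr),
      Z true false (y ∘ .inl) (w ∘ .inr) (y ∘ .inr), ?_, by simpa [Z] using hi,
      by simpa [hZ, select, hsum] using hne⟩
    rintro ((_ | j) | (_ | (j | j))) hj <;> simp_all [Z]

theorem exists_computesHF_doubling {S T : Type} [Fintype S] [DecidableEq S] [Fintype T]
    [DecidableEq T] {g : (S ⊕ T → Bool) → Bool} {A : TDT (S ⊕ T)} (hA : ComputesHF g A) :
    ∃ B : TDT (Option S ⊕ Option (T ⊕ T)), ComputesHF (doubling g) B ∧ B.depth ≤ A.depth + 2 := by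
  refine ⟨selectTree (.inl none) (.inr none) (A.rename (Sum.map some (some ∘ Sum.inl)))
    (A.rename (Sum.map some (some ∘ Sum.inr))), ?_,
    depth_selectTree_le _ _ (A.depth_rename _).le (A.depth_rename _).le⟩
  refine computesHF_selectTree (by simp) ?_ ?_ ?_ ?_ (hA.rename ?_) (hA.rename ?_)
  iterate 4
    · intro x b
      rw [Function.update_comp_eq_of_forall_ne]
      rintro (i | i) <;> simp
  · exact (Option.some_injective _).sumMap ((Option.some_injective _).comp Sum.inl_injective)
  · exact (Option.some_injective _).sumMap ((Option.some_injective _).comp Sum.inr_injective)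

theorem exists_nondegenerate_small_depth_sum (n : ℕ) :
    ∃ (S T : Type) (_ : Fintype S) (_ : DecidableEq S) (_ : Fintype T) (_ : DecidableEq T)
      (g : (S ⊕ T → Bool) → Bool) (A : TDT (S ⊕ T)),
      Fintype.card S = n ∧ Fintype.card T + 1 = 2 ^ (n + 1) ∧ Nondegenerate g ∧
        (∃ x, g x = true) ∧ ComputesHF g A ∧ A.depth ≤ 2 * n + 1 := by
  induction n with
  | zero =>
    refine ⟨Empty, Unit, inferInstance, inferInstance, inferInstance, inferInstance,
      fun x => x (.inr ()),
      .node (.inr ()) (.leaf (some false)) (.leaf none) (.leaf (some true)), rfl, rfl, ?_,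
      ⟨fun _ => true, rfl⟩, ?_, le_rfl⟩
    · rintro (⟨⟨⟩⟩ | ⟨⟨⟩⟩)
      refine ⟨fun _ => false, fun _ => true, ?_, by simp, by simp⟩
      rintro (⟨⟨⟩⟩ | ⟨⟨⟩⟩) hj
      exact absurd rfl hj
    · rw [computesHF_iff]
      intro y b
      have : (∀ x, Resolves y x → x (.inr ()) = b) ↔ y (.inr ()) = some b := by
        obtain ⟨w, hw⟩ := exists_resolves y
        refine ⟨fun h => ?_, fun h x hx => by simpa [h, eq_comm] using hx (.inr ())⟩
        rcases hw (.inr ()) with hy | hy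
        · have := h _ (hw.update (b := !b) (.inl hy))
          simp at this
        · rw [hy, h w hw]
      rw [this]
      rcases h : y (.inr ()) with _ | _ | _ <;> simp [TDT.eval, h]
  | succ n ih =>
    obtain ⟨S, T, _, _, _, _, g, A, hS, hT, hg, htrue, hA, hd⟩ := ih
    obtain ⟨B, hB, hBd⟩ := exists_computesHF_doubling hA
    refine ⟨Option S, Option (T ⊕ T), inferInstance, inferInstance, inferInstance, inferInstance,
      doubling g, B, by simp [hS], ?_, hg.doubling htrue, ?_, hB, by omega⟩
    · rw [Fintype.card_option, Fintype.card_sum, pow_succ, ← hT]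
      ring
    · exact ⟨fun _ => true, rfl⟩

theorem Nondegenerate.rename {α κ : Type} {f : (α → Bool) → Bool} (hf : Nondegenerate f)
    (φ : α ≃ κ) : Nondegenerate fun z : κ → Bool => f (z ∘ φ) := by
  intro k
  obtain ⟨x, y, hxy, hk, hne⟩ := hf (φ.symm k)
  refine ⟨x ∘ φ.symm, y ∘ φ.symm, fun j hj => hxy _ (by simpa using hj), hk, ?_⟩
  simpa [Function.comp_assoc] using hne

/-- for every `n ≥ 1` there is a non-degenerate Boolean function on
`n + 2^{n+1} − 1` inputs computed by a hazard-free decision tree of depth `2n + 1`. -/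
theorem exists_nondegenerate_small_depth (n : ℕ) (hn : 1 ≤ n) :
    ∃ f : (Fin (n + 2 ^ (n + 1) - 1) → Bool) → Bool, Nondegenerate f ∧
      ∃ T : TDT (Fin (n + 2 ^ (n + 1) - 1)), ComputesHF f T ∧ T.depth ≤ 2 * n + 1 := by
  obtain ⟨S, T, _, _, _, _, g, A, hS, hT, hg, -, hA, hd⟩ := exists_nondegenerate_small_depth_sum n
  have hcard : Fintype.card (S ⊕ T) = n + 2 ^ (n + 1) - 1 := by
    rw [Fintype.card_sum]
    omega
  let φ := Fintype.equivFinOfCardEq hcard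
  exact ⟨_, hg.rename φ, A.rename φ, hA.rename φ.injective, (A.depth_rename φ).trans_le hd⟩

end HF
end

section
/- For every Boolean function f : {0,1}^n → {0,1}, the minimum number of leaves of a hazard-free decision tree computing f satisfies size_u(f) ≥ m + M, where m is the number of prime implicants of f and M is the number of prime implicates of f. -/
namespace HF

variable {ι : Type} [Fintype ι] [DecidableEq ι]

/-- The position, from left to right, of the leaf reached on input `x`. -/
def TDT.leafIndex : TDT ι → (ι → K) → ℕ
  | .leaf _, _ => 0
  | .node i t0 tu t1, x =>
    match x i with
    | some false => leafIndex t0 x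
    | none => t0.size + leafIndex tu x
    | some true => t0.size + tu.size + leafIndex t1 x

/-- The greatest lower bound of two inputs in the instability order. -/
def meet (x y : ι → K) : ι → K := fun i => if x i = y i then x i else none

omit [Fintype ι] [DecidableEq ι] in
theorem TDT.leafIndex_lt_size (T : TDT ι) (x : ι → K) : T.leafIndex x < T.size := by
  induction T with
  | leaf b => simp [leafIndex, size]
  | node i t0 tu t1 h0 hu h1 =>
    rcases h : x i with _ | _ | _ <;> simp only [leafIndex, size, h] <;> omega

omit [Fintype ι] [DecidableEq ι] in
/-- If two inputs reach the same leaf, then so does their meet. -/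
theorem TDT.eval_of_leafIndex_eq (T : TDT ι) {x y : ι → K}
    (hxy : T.leafIndex x = T.leafIndex y) :
    T.eval x = T.eval y ∧ T.eval (meet x y) = T.eval x := by
  induction T with
  | leaf b => simp [eval]
  | node i t0 tu t1 h0 hu h1 =>
    have hx0 := t0.leafIndex_lt_size x
    have hy0 := t0.leafIndex_lt_size y
    have hxu := tu.leafIndex_lt_size x
    have hyu := tu.leafIndex_lt_size y
    rcases hx : x i with _ | _ | _ <;> rcases hy : y i with _ | _ | _ <;>
      simp only [leafIndex, hx, hy] at hxy <;>
      first
      | omega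
      | (have hm : meet x y i = x i := by simp [meet, hx, hy]
         rw [hx] at hm
         simp only [eval, hx, hy, hm]
         first
         | exact h0 (by omega)
         | exact hu (by omega)
         | exact h1 (by omega))

omit [Fintype ι] [DecidableEq ι] in
/-- Two inputs that are minimal among those with value `b` coincide if they reach the same leaf. -/
theorem eq_of_leafIndex_eq {g : (ι → K) → K} {T : TDT ι} (hT : ComputesT g T) {b : K}
    {p q : ι → K} (hp : g p = b) (hp' : ∀ r, StrictBelow r p → g r ≠ b)
    (hq' : ∀ r, StrictBelow r q → g r ≠ b) (h : T.leafIndex p = T.leafIndex q) : p = q := by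
  have hm : g (meet p q) = b := by
    rw [← hT, (T.eval_of_leafIndex_eq h).2, hT, hp]
  have hmp : meet p q = p := by
    by_contra hne
    refine hp' _ ⟨fun i => ?_, hne⟩ hm
    by_cases hi : p i = q i <;> simp [meet, hi]
  have hmq : meet p q = q := by
    by_contra hne
    refine hq' _ ⟨fun i => ?_, hne⟩ hm
    by_cases hi : p i = q i <;> simp [meet, hi]
  exact hmp.symm.trans hmq

omit [Fintype ι] in
theorem exists_computesT_of_dependsOn (s : Finset ι) (g : (ι → K) → K)
    (hg : ∀ x y, (∀ i ∈ s, x i = y i) → g x = g y) : ∃ T : TDT ι, ComputesT g T := by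
  induction s using Finset.induction_on generalizing g with
  | empty => exact ⟨.leaf (g fun _ => none), fun x => hg _ _ (by simp)⟩
  | insert i s _ ih =>
    have key (b : K) : ∃ T : TDT ι, ComputesT (fun x => g (Function.update x i b)) T := by
      refine ih _ fun x y hxy => hg _ _ fun j hj => ?_
      by_cases hji : j = i
      · subst hji; simp
      · simpa [hji] using hxy j (Finset.mem_of_mem_insert_of_ne hj hji)
    obtain ⟨t0, h0⟩ := key (some false)
    obtain ⟨tu, hu⟩ := key none
    obtain ⟨t1, h1⟩ := key (some true)
    refine ⟨.node i t0 tu t1, fun x => ?_⟩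
    rcases h : x i with _ | _ | _ <;> simp only [TDT.eval, h]
    · simpa [← h] using hu x
    · simpa [← h] using h0 x
    · simpa [← h] using h1 x

theorem exists_computesT (g : (ι → K) → K) : ∃ T : TDT ι, ComputesT g T :=
  exists_computesT_of_dependsOn Finset.univ g fun x y h => by
    rw [funext fun i => h i (Finset.mem_univ i)]

theorem ncard_add_ncard_le_size {f : (ι → Bool) → Bool} {T : TDT ι} (hT : ComputesHF f T) :
    Set.ncard {p : ι → K | PrimeImplicant f p} +
      Set.ncard {p : ι → K | PrimeImplicate f p} ≤ T.size := by
  have hdisj : Disjoint {p : ι → K | PrimeImplicant f p} {p | PrimeImplicate f p} :=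
    Set.disjoint_left.2 fun p hp hq => by simpa using hp.1.symm.trans hq.1
  rw [← Set.ncard_union_eq hdisj]
  have hne {p q : ι → K} (hp : PrimeImplicant f p) (hq : PrimeImplicate f q) :
      T.leafIndex p ≠ T.leafIndex q := fun h => by
    have := (T.eval_of_leafIndex_eq h).1
    rw [hT, hT, hp.1, hq.1] at this
    simp at this
  calc _ ≤ (Set.Iio T.size).ncard := by
        refine Set.ncard_le_ncard_of_injOn T.leafIndex
          (fun p _ => T.leafIndex_lt_size p) ?_
        rintro p (hp | hp) q (hq | hq) h
        · exact eq_of_leafIndex_eq hT hp.1 hp.2 hq.2 h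
        · exact (hne hp hq h).elim
        · exact (hne hq hp h.symm).elim
        · exact eq_of_leafIndex_eq hT hp.1 hp.2 hq.2 h
    _ = T.size := by rw [Set.ncard_eq_toFinset_card']; simp

/-- `size_u(f) ≥ m + M` where `m` (resp. `M`) is the number of prime
implicants (resp. prime implicates) of `f`. -/
theorem hazard_free_size_ge_implicants (n : ℕ) (f : (Fin n → Bool) → Bool) :
    Set.ncard {p : Fin n → K | PrimeImplicant f p} +
      Set.ncard {p : Fin n → K | PrimeImplicate f p} ≤ sizeU f := by
  obtain ⟨T, hT⟩ := exists_computesT (hfExt f)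
  obtain ⟨T', hT', hs⟩ := Nat.sInf_mem
    (s := {s | ∃ T : TDT (Fin n), ComputesHF f T ∧ T.size = s}) ⟨_, T, hT, rfl⟩
  exact (ncard_add_ncard_le_size hT').trans_eq hs

end HF
end

section
/- Let f : {0,1}^n → {0,1} be a non-constant Boolean function, let k_1 be the minimum k such that f̃ is computed hazard-freely by a k-DNF formula, and let k_2 be the minimum k such that f̃ is computed hazard-freely by a k-CNF formula. Then max{k_1, k_2} ≤ s_u(f̃) ≤ bs_u(f̃) ≤ cc_u(f̃) ≤ k_1 + k_2 − 1. -/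
namespace HF

variable {ι : Type} [Fintype ι] [DecidableEq ι]

theorem hfExt_eq_none_iff (f : (ι → Bool) → Bool) (y : ι → K) :
    hfExt f y = none ↔
      (∃ z, Resolves y z ∧ f z = true) ∧ ∃ w, Resolves y w ∧ f w = false := by
  have ht := hfExt_eq_some_iff f y true
  have hf := hfExt_eq_some_iff f y false
  have h : hfExt f y = none ↔ hfExt f y ≠ some true ∧ hfExt f y ≠ some false := by
    rcases hfExt f y with _ | _ | _ <;> simp
  rw [h, Ne, Ne, ht, hf]
  push Not
  simp only [ne_eq, Bool.not_eq_true, Bool.not_eq_false]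
  exact and_comm

theorem hfExt_some (f : (ι → Bool) → Bool) (x : ι → Bool) :
    hfExt f (fun i => some (x i)) = some (f x) := by
  rw [hfExt_eq_some_iff]
  intro y hy
  congr 1
  funext i
  simpa [eq_comm] using hy i

theorem Below.resolves {α : Type} {p x : α → K} (h : Below p x) {z : α → Bool} (hz : Resolves x z) :
    Resolves p z := by
  intro i
  rcases h i with h | h
  · exact Or.inl h
  · rw [h]
    exact hz i

theorem litEval_eq_some_iff {α : Type} (x : α → K) (l : α × Bool) (b : Bool) :
    litEval x l = some b ↔ x l.1 = some (b == l.2) := by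
  obtain ⟨i, a⟩ := l
  unfold litEval
  cases a <;> cases b <;> rcases x i with _ | _ | _ <;> simp

theorem dnfEval_eq_true_iff (D : Finset (Finset (ι × Bool))) (x : ι → K) :
    dnfEval D x = some true ↔ ∃ t ∈ D, ∀ l ∈ t, x l.1 = some l.2 := by
  have ht (t : Finset (ι × Bool)) :
      termEval t x = some true ↔ ∀ l ∈ t, x l.1 = some l.2 := by
    unfold termEval
    split_ifs <;> simp_all [litEval_eq_some_iff]
  unfold dnfEval
  simp only [ht]
  split_ifs <;> simp_all

theorem dnfEval_eq_false_iff (D : Finset (Finset (ι × Bool))) (x : ι → K) :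
    dnfEval D x = some false ↔ ∀ t ∈ D, ∃ l ∈ t, x l.1 = some (!l.2) := by
  have ht (t : Finset (ι × Bool)) :
      termEval t x = some false ↔ ∃ l ∈ t, x l.1 = some (!l.2) := by
    unfold termEval
    simp only [litEval_eq_some_iff, Bool.true_beq, Bool.false_beq]
    split_ifs with h h'
    · simp only [Option.some.injEq, Bool.true_eq_false, false_iff]
      rintro ⟨l, hl, hx⟩
      simp [h l hl] at hx
    · simpa using h'
    · simpa using h'
  unfold dnfEval
  simp only [ht]
  split_ifs with h h'
  · simp only [Option.some.injEq, Bool.true_eq_false, false_iff]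
    intro h'
    obtain ⟨t, hD, h⟩ := h
    rw [(ht t).2 (h' t hD)] at h
    simp at h
  · simpa using h'
  · simpa using h'

theorem cnfEval_eq_true_iff (C : Finset (Finset (ι × Bool))) (x : ι → K) :
    cnfEval C x = some true ↔ ∀ c ∈ C, ∃ l ∈ c, x l.1 = some l.2 := by
  have hc (c : Finset (ι × Bool)) :
      clauseEval c x = some true ↔ ∃ l ∈ c, x l.1 = some l.2 := by
    unfold clauseEval
    simp only [litEval_eq_some_iff, Bool.true_beq, Bool.false_beq]
    split_ifs with h h' <;> simpa using h
  unfold cnfEval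
  simp only [hc]
  split_ifs with h h' <;> simpa using h

theorem cnfEval_eq_false_iff (C : Finset (Finset (ι × Bool))) (x : ι → K) :
    cnfEval C x = some false ↔ ∃ c ∈ C, ∀ l ∈ c, x l.1 = some (!l.2) := by
  have hc (c : Finset (ι × Bool)) :
      clauseEval c x = some false ↔ ∀ l ∈ c, x l.1 = some (!l.2) := by
    unfold clauseEval
    simp only [litEval_eq_some_iff, Bool.true_beq, Bool.false_beq]
    split_ifs with h h'
    · simp only [Option.some.injEq, Bool.true_eq_false, false_iff]
      intro h'
      obtain ⟨l, hl, hx⟩ := h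
      simp [h' l hl] at hx
    · simpa using h'
    · simpa using h'
  unfold cnfEval
  simp only [hc]
  split_ifs with h h'
  · simp only [Option.some.injEq, Bool.true_eq_false, false_iff]
    rintro ⟨c, hC, h'⟩
    have := h c hC
    rw [(hc c).2 h'] at this
    simp at this
  · simpa using h'
  · simpa using h'

theorem eq_of_eq_some_iff {a b : K} (ht : a = some true ↔ b = some true)
    (hf : a = some false ↔ b = some false) : a = b := by
  rcases a with _ | _ | _ <;> rcases b with _ | _ | _ <;> simp_all

/-- The points of value `b` that lose this value when any stable coordinate is made unstable. -/
def minimalPoints (f : (ι → Bool) → Bool) (b : Bool) : Set (ι → K) :=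
  {p | hfExt f p = some b ∧ ∀ i, p i ≠ none → hfExt f (Function.update p i none) ≠ some b}

theorem exists_minimalPoints_below (f : (ι → Bool) → Bool) (b : Bool) {x : ι → K}
    (hx : hfExt f x = some b) : ∃ p ∈ minimalPoints f b, Below p x := by
  obtain ⟨p, ⟨hpx, hpb⟩, hmin⟩ := Set.exists_min_image {p | Below p x ∧ hfExt f p = some b}
    (fun p => (Finset.univ.filter fun i => p i ≠ none).card) (Set.toFinite _)
    ⟨x, fun _ => Or.inr rfl, hx⟩
  refine ⟨p, ⟨hpb, fun i hi hu => ?_⟩, hpx⟩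
  refine (hmin (Function.update p i none) ⟨fun j => ?_, hu⟩).not_gt (Finset.card_lt_card ?_)
  · by_cases hj : j = i
    · subst hj
      simp
    · simpa [hj] using hpx j
  · refine Finset.ssubset_iff_of_subset (fun j => ?_) |>.2 ⟨i, by simpa using hi, by simp⟩
    by_cases hj : j = i <;> simp [hj]

theorem hfExt_eq_some_iff_exists_minimalPoints (f : (ι → Bool) → Bool) (b : Bool) (x : ι → K) :
    hfExt f x = some b ↔ ∃ p ∈ minimalPoints f b, Below p x := by
  refine ⟨exists_minimalPoints_below f b, ?_⟩
  rintro ⟨p, hp, hpx⟩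
  rw [hfExt_eq_some_iff]
  exact fun z hz => (hfExt_eq_some_iff f p b).1 hp.1 z (hpx.resolves hz)

theorem hfExt_eq_some_not_iff_forall_minimalPoints (f : (ι → Bool) → Bool) (b : Bool)
    (x : ι → K) :
    hfExt f x = some (!b) ↔
      ∀ p ∈ minimalPoints f b, ∃ i a, p i = some a ∧ x i = some (!a) := by
  rw [hfExt_eq_some_iff]
  constructor
  · intro h p hp
    by_contra! hcon
    have hx : Resolves x fun i => ((x i).orElse fun _ => p i).getD false := by
      intro i
      cases hxi : x i <;> simp [hxi]
    have hpr : Resolves p fun i => ((x i).orElse fun _ => p i).getD false := by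
      intro i
      have := hcon i
      rcases h1 : x i with _ | _ | _ <;> rcases h2 : p i with _ | _ | _ <;> simp_all
    have := (hfExt_eq_some_iff f p b).1 hp.1 _ hpr
    rw [h _ hx] at this
    simp at this
  · intro h z hz
    by_contra hfz
    have hfz : f z = b := by simpa using hfz
    obtain ⟨p, hp, hpz⟩ := exists_minimalPoints_below f b (x := fun i => some (z i))
      (by rw [hfExt_some, hfz])
    obtain ⟨i, a, hpa, hxa⟩ := h p hp
    have h1 := hpz i
    have h2 := hz i
    rw [hpa] at h1
    rw [hxa] at h2
    simp at h1 h2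
    simp [← h1] at h2

theorem card_stable_le_sens (f : (ι → Bool) → Bool) {b : Bool} {p : ι → K}
    (hp : p ∈ minimalPoints f b) :
    (Finset.univ.filter fun i => p i ≠ none).card ≤ sens (hfExt f) := by
  refine le_trans ?_ (le_ciSup (Set.finite_range (sensAt (hfExt f))).bddAbove p)
  rw [← Set.ncard_coe_finset]
  refine Set.ncard_le_ncard (fun i hi => ?_) (Set.toFinite _)
  have hi : p i ≠ none := by simpa using hi
  refine ⟨Function.update p i none, by simpa using hi.symm, fun j hj => by simp [hj], ?_⟩
  rw [hp.1]
  exact hp.2 i hi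

theorem exists_dnf (f : (ι → Bool) → Bool) :
    ∃ D : Finset (Finset (ι × Bool)), (∀ t ∈ D, t.card ≤ sens (hfExt f)) ∧
      ∀ x, dnfEval D x = hfExt f x := by
  classical
  refine ⟨(minimalPoints f true).toFinset.image fun p =>
    Finset.univ.filter fun l => p l.1 = some l.2, ?_, fun x => eq_of_eq_some_iff ?_ ?_⟩
  · intro t ht
    simp only [Finset.mem_image, Set.mem_toFinset] at ht
    obtain ⟨p, hp, rfl⟩ := ht
    refine le_trans (Finset.card_le_card_of_injOn Prod.fst ?_ ?_) (card_stable_le_sens f hp)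
    · intro l hl
      simp_all
    · rintro ⟨i, a⟩ hl ⟨j, c⟩ hm rfl
      simp_all
  · rw [dnfEval_eq_true_iff, hfExt_eq_some_iff_exists_minimalPoints]
    simp only [Finset.mem_image, Set.mem_toFinset, exists_exists_and_eq_and]
    refine exists_congr fun p => and_congr_right fun _ => ⟨fun h i => ?_, fun h l hl => ?_⟩
    · cases hi : p i with
      | none => exact Or.inl rfl
      | some a => exact Or.inr (h (i, a) (by simpa using hi)).symm
    · have hl : p l.1 = some l.2 := by simpa using hl
      simpa [hl, eq_comm] using h l.1
  · rw [dnfEval_eq_false_iff, ← Bool.not_true, hfExt_eq_some_not_iff_forall_minimalPoints]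
    simp

theorem exists_cnf (f : (ι → Bool) → Bool) :
    ∃ C : Finset (Finset (ι × Bool)), (∀ c ∈ C, c.card ≤ sens (hfExt f)) ∧
      ∀ x, cnfEval C x = hfExt f x := by
  classical
  refine ⟨(minimalPoints f false).toFinset.image fun p =>
    Finset.univ.filter fun l => p l.1 = some (!l.2), ?_, fun x => eq_of_eq_some_iff ?_ ?_⟩
  · intro c hc
    simp only [Finset.mem_image, Set.mem_toFinset] at hc
    obtain ⟨p, hp, rfl⟩ := hc
    refine le_trans (Finset.card_le_card_of_injOn Prod.fst ?_ ?_) (card_stable_le_sens f hp)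
    · intro l hl
      simp_all
    · rintro ⟨i, a⟩ hl ⟨j, c⟩ hm rfl
      simp_all
  · rw [cnfEval_eq_true_iff, ← Bool.not_false, hfExt_eq_some_not_iff_forall_minimalPoints]
    simp [or_comm]
  · rw [cnfEval_eq_false_iff, hfExt_eq_some_iff_exists_minimalPoints]
    simp only [Finset.mem_image, Set.mem_toFinset, exists_exists_and_eq_and]
    refine exists_congr fun p => and_congr_right fun _ => ⟨fun h i => ?_, fun h l hl => ?_⟩
    · cases hi : p i with
      | none => exact Or.inl rfl
      | some a => exact Or.inr (by simpa using (h (i, !a) (by simpa using hi)).symm)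
    · have hl : p l.1 = some (!l.2) := by simpa using hl
      simpa [hl, eq_comm] using h l.1

theorem card_le_of_disjoint_of_inter_nonempty {α : Type} {k : ℕ} {B : Fin k → Finset α}
    {S : Finset α} (hdisj : ∀ j j', j ≠ j' → Disjoint (B j) (B j')) (hS : ∀ j, ∃ i ∈ B j, i ∈ S) :
    k ≤ S.card := by
  choose r hrB hrS using hS
  have hinj : Function.Injective r := by
    intro j j' h
    by_contra hne
    exact Finset.disjoint_left.1 (hdisj j j' hne) (hrB j) (h ▸ hrB j')
  simpa using Finset.card_le_card_of_injOn (s := Finset.univ) r (fun j _ => hrS j) hinj.injOn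

theorem sens_le_bsens (g : (ι → K) → K) : sens g ≤ bsens g := by
  refine ciSup_le' fun x => le_trans ?_ (le_ciSup (Set.finite_range (bsensAt g)).bddAbove x)
  refine le_csSup ⟨Fintype.card ι, ?_⟩ ?_
  · rintro k ⟨B, hne, hdisj, -⟩
    exact card_le_of_disjoint_of_inter_nonempty (S := Finset.univ) hdisj
      fun j => (hne j).imp fun i hi => ⟨hi, Finset.mem_univ i⟩
  · unfold sensAt
    set T := {i : ι | ∃ y : ι → K, y i ≠ x i ∧ (∀ j, j ≠ i → y j = x j) ∧ g y ≠ g x}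
    let e : Fin T.ncard ≃ T := (Finite.equivFinOfCardEq (Nat.card_coe_set_eq T)).symm
    refine ⟨fun j => {(e j : ι)}, fun j => Finset.singleton_nonempty _, fun j j' hj => ?_,
      fun j => ?_⟩
    · simpa [Subtype.val_inj] using hj
    · obtain ⟨y, hyi, hy, hg⟩ := (e j).2
      refine ⟨y, fun i => ?_, hg⟩
      rw [Finset.mem_singleton]
      refine ⟨fun h => ?_, fun h => h ▸ hyi⟩
      by_contra hne
      exact h (hy i hne)

theorem bsens_le_cc (g : (ι → K) → K) : bsens g ≤ cc g := by
  refine ciSup_le' fun x => le_trans ?_ (le_ciSup (Set.finite_range (ccAt g)).bddAbove x)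
  obtain ⟨S, hcard, hS⟩ := Nat.sInf_mem (s := {k : ℕ | ∃ S : Finset ι, S.card = k ∧
    ∀ y : ι → K, (∀ i ∈ S, y i = x i) → g y = g x})
    ⟨_, Finset.univ, rfl, fun y hy => by rw [funext fun i => hy i (Finset.mem_univ i)]⟩
  refine csSup_le' ?_
  rintro k ⟨B, -, hdisj, hB⟩
  unfold ccAt
  rw [← hcard]
  refine card_le_of_disjoint_of_inter_nonempty hdisj fun j => ?_
  obtain ⟨y, hy, hg⟩ := hB j
  by_contra! hcon
  exact hg (hS y fun i hi => by
    by_contra hne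
    exact hcon i ((hy i).1 hne) hi)

theorem ccAt_le {α : Type} {g : (α → K) → K} {x : α → K} {k : ℕ} (S : Finset α) (hk : S.card ≤ k)
    (hS : ∀ y : α → K, (∀ i ∈ S, y i = x i) → g y = g x) : ccAt g x ≤ k :=
  le_trans (by exact Nat.sInf_le ⟨S, rfl, hS⟩) hk

/-- A term satisfied by a `1`-point and a clause falsified by a `0`-point share a variable. -/
theorem exists_mem_term_mem_clause {f : (ι → Bool) → Bool} {D C : Finset (Finset (ι × Bool))}
    (hD : ∀ x, dnfEval D x = hfExt f x) (hC : ∀ x, cnfEval C x = hfExt f x)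
    {t c : Finset (ι × Bool)} (ht : t ∈ D) (hc : c ∈ C) {z w : ι → Bool}
    (hz : ∀ l ∈ t, z l.1 = l.2) (hw : ∀ l ∈ c, w l.1 = !l.2) :
    ∃ i, i ∈ t.image Prod.fst ∧ i ∈ c.image Prod.fst := by
  by_contra! hcon
  let v : ι → K := fun i => some (if i ∈ t.image Prod.fst then z i else w i)
  have hvt : dnfEval D v = some true := by
    refine (dnfEval_eq_true_iff D v).2 ⟨t, ht, fun l hl => ?_⟩
    simp only [v, if_pos (Finset.mem_image_of_mem Prod.fst hl), hz l hl]
  have hvf : cnfEval C v = some false := by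
    refine (cnfEval_eq_false_iff C v).2 ⟨c, hc, fun l hl => ?_⟩
    have hl' : l.1 ∉ t.image Prod.fst := fun h =>
      hcon _ h (Finset.mem_image_of_mem Prod.fst hl)
    simp only [v, if_neg hl', hw l hl]
  rw [hD] at hvt
  rw [hC, hvt] at hvf
  simp at hvf

theorem exists_term_of_eq_true {f : (ι → Bool) → Bool} {D : Finset (Finset (ι × Bool))}
    (hD : ∀ x, dnfEval D x = hfExt f x) {z : ι → Bool} (hz : f z = true) :
    ∃ t ∈ D, ∀ l ∈ t, z l.1 = l.2 := by
  have := (dnfEval_eq_true_iff D fun i => some (z i)).1 (by rw [hD, hfExt_some, hz])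
  simpa using this

theorem exists_clause_of_eq_false {f : (ι → Bool) → Bool} {C : Finset (Finset (ι × Bool))}
    (hC : ∀ x, cnfEval C x = hfExt f x) {w : ι → Bool} (hw : f w = false) :
    ∃ c ∈ C, ∀ l ∈ c, w l.1 = !l.2 := by
  have := (cnfEval_eq_false_iff C fun i => some (w i)).1 (by rw [hC, hfExt_some, hw])
  simpa using this

theorem cc_le_of_dnf_of_cnf {f : (ι → Bool) → Bool} (hnc : ∃ x y, f x ≠ f y)
    {D C : Finset (Finset (ι × Bool))} {k₁ k₂ : ℕ}
    (hDk : ∀ t ∈ D, t.card ≤ k₁) (hD : ∀ x, dnfEval D x = hfExt f x)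
    (hCk : ∀ c ∈ C, c.card ≤ k₂) (hC : ∀ x, cnfEval C x = hfExt f x) :
    cc (hfExt f) ≤ k₁ + k₂ - 1 := by
  have hvars {z w : ι → Bool} (hz : f z = true) (hw : f w = false) :
      ∃ t ∈ D, ∃ c ∈ C, (∀ l ∈ t, z l.1 = l.2) ∧ (∀ l ∈ c, w l.1 = !l.2) ∧
        ∃ i, i ∈ t.image Prod.fst ∧ i ∈ c.image Prod.fst := by
    obtain ⟨t, ht, hzt⟩ := exists_term_of_eq_true hD hz
    obtain ⟨c, hc, hwc⟩ := exists_clause_of_eq_false hC hw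
    exact ⟨t, ht, c, hc, hzt, hwc, exists_mem_term_mem_clause hD hC ht hc hzt hwc⟩
  have hpos : 1 ≤ k₁ ∧ 1 ≤ k₂ := by
    obtain ⟨z, w, hz, hw⟩ : ∃ z w, f z = true ∧ f w = false := by
      obtain ⟨x, y, hxy⟩ := hnc
      cases hx : f x
      · exact ⟨y, x, by simpa [hx] using hxy.symm, hx⟩
      · exact ⟨x, y, hx, by simpa [hx] using hxy.symm⟩
    obtain ⟨t, ht, c, hc, -, -, i, hit, hic⟩ := hvars hz hw
    have ht₀ : t.Nonempty := Finset.image_nonempty.1 ⟨i, hit⟩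
    have hc₀ : c.Nonempty := Finset.image_nonempty.1 ⟨i, hic⟩
    exact ⟨ht₀.card_pos.trans_le (hDk t ht), hc₀.card_pos.trans_le (hCk c hc)⟩
  refine ciSup_le' fun x => ?_
  rcases hx : hfExt f x with _ | _ | _
  · obtain ⟨⟨z, hxz, hz⟩, w, hxw, hw⟩ := (hfExt_eq_none_iff f x).1 hx
    obtain ⟨t, ht, c, hc, hzt, hwc, i, hit, hic⟩ := hvars hz hw
    refine ccAt_le (t.image Prod.fst ∪ c.image Prod.fst) ?_ fun y hy => ?_
    · have h1 := Finset.card_union_add_card_inter (t.image Prod.fst) (c.image Prod.fst)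
      have h2 : 0 < (t.image Prod.fst ∩ c.image Prod.fst).card :=
        Finset.card_pos.2 ⟨i, Finset.mem_inter.2 ⟨hit, hic⟩⟩
      have h3 := (Finset.card_image_le (s := t) (f := Prod.fst)).trans (hDk t ht)
      have h4 := (Finset.card_image_le (s := c) (f := Prod.fst)).trans (hCk c hc)
      omega
    · have hnf : hfExt f y ≠ some false := by
        rw [← hD, Ne, dnfEval_eq_false_iff]
        intro h
        obtain ⟨l, hl, hyl⟩ := h t ht
        rw [hy _ (Finset.mem_union_left _ (Finset.mem_image_of_mem Prod.fst hl))] at hyl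
        have := hxz l.1
        simp [hyl, hzt l hl] at this
      have hnt : hfExt f y ≠ some true := by
        rw [← hC, Ne, cnfEval_eq_true_iff]
        intro h
        obtain ⟨l, hl, hyl⟩ := h c hc
        rw [hy _ (Finset.mem_union_right _ (Finset.mem_image_of_mem Prod.fst hl))] at hyl
        have := hxw l.1
        simp [hyl, hwc l hl] at this
      rw [hx]
      rcases h : hfExt f y with _ | _ | _
      · rfl
      · exact absurd h hnf
      · exact absurd h hnt
  · obtain ⟨c, hc, hxc⟩ := (cnfEval_eq_false_iff C x).1 ((hC x).trans hx)
    refine ccAt_le (c.image Prod.fst)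
      ((Finset.card_image_le.trans (hCk c hc)).trans (by omega)) fun y hy => ?_
    rw [hx, ← hC, cnfEval_eq_false_iff]
    exact ⟨c, hc, fun l hl => (hy _ (Finset.mem_image_of_mem Prod.fst hl)).trans (hxc l hl)⟩
  · obtain ⟨t, ht, hxt⟩ := (dnfEval_eq_true_iff D x).1 ((hD x).trans hx)
    refine ccAt_le (t.image Prod.fst)
      ((Finset.card_image_le.trans (hDk t ht)).trans (by omega)) fun y hy => ?_
    rw [hx, ← hD, dnfEval_eq_true_iff]
    exact ⟨t, ht, fun l hl => (hy _ (Finset.mem_image_of_mem Prod.fst hl)).trans (hxt l hl)⟩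

/-- `max{k₁,k₂} ≤ s_u(f̃) ≤ bs_u(f̃) ≤ cc_u(f̃) ≤ k₁ + k₂ − 1`, where `k₁`
(resp. `k₂`) is the least width of a hazard-free DNF (resp. CNF) for `f`. -/
theorem sens_bsens_cc_dnf_cnf (n : ℕ) (f : (Fin n → Bool) → Bool)
    (hnc : ∃ x y, f x ≠ f y) (k1 k2 : ℕ)
    (h1 : IsLeast {k : ℕ | ∃ D : Finset (Finset (Fin n × Bool)),
      (∀ t ∈ D, t.card ≤ k) ∧ ∀ x, dnfEval D x = hfExt f x} k1)
    (h2 : IsLeast {k : ℕ | ∃ C : Finset (Finset (Fin n × Bool)),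
      (∀ c ∈ C, c.card ≤ k) ∧ ∀ x, cnfEval C x = hfExt f x} k2) :
    max k1 k2 ≤ sens (hfExt f) ∧ sens (hfExt f) ≤ bsens (hfExt f) ∧
      bsens (hfExt f) ≤ cc (hfExt f) ∧ cc (hfExt f) ≤ k1 + k2 - 1 := by
  obtain ⟨⟨D, hDk, hD⟩, hmin₁⟩ := h1
  obtain ⟨⟨C, hCk, hC⟩, hmin₂⟩ := h2
  exact ⟨max_le (hmin₁ (exists_dnf f)) (hmin₂ (exists_cnf f)), sens_le_bsens _, bsens_le_cc _,
    cc_le_of_dnf_of_cnf hnc hDk hD hCk hC⟩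

end HF
end
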